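/- arXiv:1610.05199 — 3 statements merged into one kernel-verified Lean document; each statement's English description precedes it below -/
import Mathlib

section
/- (Contraction principle.) Let (X,d) be a metric space, T ⊆ X, α > 0 and p ≥ 1. Suppose that functions s_n : T → [0,∞) (n ≥ 0) and a constant a ≥ 0 satisfy e_n(A) ≤ a·diam(A) + sup_{x∈A} s_n(x) for every n ≥ 0 and every subset A ⊆ T. Then there is a constant C depending only on α such that γ_{α,p}(T) ≤ C · ( a·γ_{α,p}(T) + [sup_{x∈T} Σ_{n≥0} (2^{n/α} s_n(x))^p]^{1/p} ). -/
open scoped ENNReal NNReal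
open EMetric Set

noncomputable section

universe u

/-- Diameter of a set with respect to an extended distance function `D`. -/
def eDiam {X : Type u} (D : X → X → ℝ≥0∞) (A : Set X) : ℝ≥0∞ :=
  ⨆ x ∈ A, ⨆ y ∈ A, D x y

/-- Entropy numbers: `entN D n A` is the infimum over sets `S` of cardinality
less than `2^(2^n)` of `sup_{x ∈ A} D(x, S)`. -/
def entN {X : Type u} (D : X → X → ℝ≥0∞) (n : ℕ) (A : Set X) : ℝ≥0∞ :=
  ⨅ (S : Finset X) (_ : S.card < 2 ^ 2 ^ n), ⨆ x ∈ A, ⨅ y ∈ S, D x y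

/-- An admissible sequence of a set `T`: an increasing (refining) sequence of
partitions of `T`, the `n`-th one having fewer than `2^(2^n)` pieces.
`piece n x` is the element of the `n`-th partition containing `x`. -/
structure Admissible {X : Type u} (T : Set X) where
  piece : ℕ → X → Set X
  self_mem : ∀ n, ∀ x ∈ T, x ∈ piece n x
  subset_base : ∀ n, ∀ x ∈ T, piece n x ⊆ T
  partition : ∀ n, ∀ x ∈ T, ∀ y ∈ T, y ∈ piece n x → piece n y = piece n x
  finite_pieces : ∀ n, {A : Set X | ∃ x ∈ T, piece n x = A}.Finite
  card_pieces : ∀ n, {A : Set X | ∃ x ∈ T, piece n x = A}.ncard < 2 ^ 2 ^ n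
  nested : ∀ n, ∀ x ∈ T, piece (n + 1) x ⊆ piece n x

/-- The chaining functional `γ_{α,p}(T)` with respect to the extended distance `D`. -/
def gammaF {X : Type u} (D : X → X → ℝ≥0∞) (α p : ℝ) (T : Set X) : ℝ≥0∞ :=
  ⨅ P : Admissible T,
    (⨆ x ∈ T, ∑' n : ℕ, ((2 : ℝ≥0∞) ^ ((n : ℝ) / α) * eDiam D (P.piece n x)) ^ p) ^ p⁻¹


lemma exists_label {X : Type u} [MetricSpace X] (n : ℕ) (A : Set X) (r ε : ℝ≥0∞) (hε : ε ≠ 0)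
    (h : entN (edist : X → X → ℝ≥0∞) n A ≤ r) :
    ∃ f : X → Fin (2 ^ 2 ^ n), ∀ x ∈ A, ∀ y ∈ A, f x = f y → edist x y ≤ 2 * (r + ε) := by
  classical
  have : NeZero (2 ^ 2 ^ n) := ⟨by positivity⟩
  by_cases hr : r + ε = ∞
  · exact ⟨fun _ => 0, fun x _ y _ _ => by rw [hr]; simp⟩
  have hlt : entN (edist : X → X → ℝ≥0∞) n A < r + ε :=
    lt_of_le_of_lt h (ENNReal.lt_add_right (fun h => hr (by simp [h])) hε)
  unfold entN at hlt
  simp only [iInf_lt_iff] at hlt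
  obtain ⟨S, hS, hlt⟩ := hlt
  have hx : ∀ x ∈ A, ∃ y ∈ S, edist x y < r + ε := by
    intro x hx
    have : ⨅ y ∈ S, edist x y < r + ε := lt_of_le_of_lt (le_iSup₂ (f := fun x (_ : x ∈ A) => ⨅ y ∈ S, edist x y) x hx) hlt
    simp only [iInf_lt_iff] at this
    obtain ⟨y, hy, h⟩ := this
    exact ⟨y, hy, h⟩
  choose! c hcS hc using hx
  obtain ⟨g, -, hg⟩ := (S.finite_toSet).exists_injOn_of_encard_le (t := (univ : Set (Fin (2 ^ 2 ^ n))))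
    (by simp; exact_mod_cast hS.le)
  refine ⟨fun x => g (c x), fun x hx y hy hxy => ?_⟩
  have e := hg (hcS x hx) (hcS y hy) hxy
  calc edist x y ≤ edist x (c x) + edist y (c x) := edist_triangle_right _ _ _
    _ ≤ (r + ε) + (r + ε) := add_le_add (hc x hx).le (by rw [e]; exact (hc y hy).le)
    _ = _ := by ring

/-- Admissible sequence generated by label functions. -/
lemma exists_adm {X : Type u} (T : Set X)
    (l : ∀ k : ℕ, X → Fin (2 ^ 2 ^ k) × Fin (2 ^ 2 ^ k) × Fin (2 ^ 2 ^ k)) :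
    ∃ Q : Admissible T, ∀ m x, Q.piece m x = {y ∈ T | ∀ k, k + 3 ≤ m → l k y = l k x} := by
  classical
  have key : ∀ n : ℕ, {A : Set X | ∃ x ∈ T, {y ∈ T | ∀ k, k + 3 ≤ n → l k y = l k x} = A} ⊆
      range (fun φ : (∀ k : Fin (n - 2), Fin (2 ^ 2 ^ (k:ℕ)) × Fin (2 ^ 2 ^ (k:ℕ)) × Fin (2 ^ 2 ^ (k:ℕ))) =>
        {y ∈ T | ∀ k : Fin (n - 2), l k y = φ k}) := by
    rintro n A ⟨x, hx, rfl⟩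
    refine ⟨fun k => l k x, ?_⟩
    ext y
    simp only [mem_ofPred_eq, and_congr_right_iff]
    intro _
    constructor
    · intro h k hk
      exact h ⟨k, by omega⟩
    · intro h k
      exact h k (by omega)
  have hcard : ∀ j : ℕ, (∏ k : Fin j, (2 ^ 2 ^ (k:ℕ) * (2 ^ 2 ^ (k:ℕ) * 2 ^ 2 ^ (k:ℕ)) : ℕ)) * 2 ^ 3 = 2 ^ (3 * 2 ^ j) := by
    intro j
    induction j with
    | zero => simp
    | succ j ih =>
      rw [Fin.prod_univ_castSucc]
      simp only [Fin.val_castSucc, Fin.val_last]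
      rw [mul_right_comm, ih, ← pow_add, ← pow_add, ← pow_add]
      congr 1
      ring
  refine ⟨⟨fun m x => {y ∈ T | ∀ k, k + 3 ≤ m → l k y = l k x}, ?_, ?_, ?_, ?_, ?_, ?_⟩, fun _ _ => rfl⟩
  · intro n x hx
    exact ⟨hx, fun _ _ => rfl⟩
  · intro n x hx y hy
    exact hy.1
  · intro n x hx y hy hxy
    ext z
    simp only [mem_ofPred_eq, and_congr_right_iff]
    intro _
    refine forall_congr' fun k => forall_congr' fun hk => ?_
    rw [hxy.2 k hk]
  · intro n
    exact (finite_range _).subset (key n)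
  · intro n
    refine lt_of_le_of_lt (ncard_le_ncard (key n) (finite_range _)) ?_
    rw [← image_univ]
    refine lt_of_le_of_lt (ncard_image_le finite_univ) ?_
    rw [ncard_univ, Nat.card_eq_fintype_card, Fintype.card_pi]
    simp only [Fintype.card_prod, Fintype.card_fin]
    have h1 := hcard (n - 2)
    have h2 : 2 ^ (3 * 2 ^ (n - 2)) < 2 ^ 2 ^ n * 2 ^ 3 := by
      rw [← pow_add]
      apply Nat.pow_lt_pow_right (by norm_num)
      rcases Nat.lt_or_ge n 2 with h | h
      · have : n - 2 = 0 := by omega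
        rw [this]
        have : 0 < 2 ^ n := by positivity
        omega
      · obtain ⟨j, rfl⟩ := Nat.exists_eq_add_of_le h
        have : 2 + j - 2 = j := by omega
        rw [this, pow_add]
        omega
    rw [← h1] at h2
    exact lt_of_mul_lt_mul_right h2 (by positivity)
  · intro n x hx y hy
    exact ⟨hy.1, fun k hk => hy.2 k (by omega)⟩

/-- Levels -/
lemma exists_level {X : Type u} (T : Set X) (n : ℕ) (s : X → ℝ≥0∞) (q S : ℝ≥0∞) (hq0 : q ≠ 0)
    (hqt : q ≠ ∞) (hs : ∀ x ∈ T, s x ≤ S) :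
    ∃ f : X → Fin (2 ^ 2 ^ n), ∀ x ∈ T, ∀ y ∈ T, f x = f y → s y ≤ q * s x + q⁻¹ ^ n * S := by
  classical
  have hn : n < 2 ^ 2 ^ n := lt_trans n.lt_two_pow_self (2 ^ n).lt_two_pow_self
  let F : X → ℕ := fun x => Nat.findGreatest (fun i => s x ≤ q⁻¹ ^ i * S) n
  have hF : ∀ x, F x ≤ n := fun x => Nat.findGreatest_le n
  refine ⟨fun x => ⟨F x, (hF x).trans_lt hn⟩, fun x hx y hy hxy => ?_⟩
  have hxy : F x = F y := by simpa using hxy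
  have h1 : s y ≤ q⁻¹ ^ (F y) * S :=
    Nat.findGreatest_spec (P := fun i => s y ≤ q⁻¹ ^ i * S) (Nat.zero_le n) (by simpa using hs y hy)
  rcases (hF x).lt_or_eq with h | h
  · have h2 : ¬ (s x ≤ q⁻¹ ^ (F x + 1) * S) :=
      Nat.findGreatest_is_greatest (P := fun i => s x ≤ q⁻¹ ^ i * S) (Nat.lt_succ_self _) h
    refine le_trans ?_ le_self_add
    refine h1.trans ?_
    rw [← hxy]
    calc q⁻¹ ^ F x * S = q * (q⁻¹ ^ (F x + 1) * S) := by
          rw [pow_succ, mul_comm _ q⁻¹, mul_assoc, ← mul_assoc q, ENNReal.mul_inv_cancel hq0 hqt, one_mul]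
      _ ≤ q * s x := by gcongr; exact (not_le.1 h2).le
  · rw [← hxy, h] at h1
    exact h1.trans le_add_self

lemma eDiam_le {X : Type u} [MetricSpace X] {A : Set X} {r : ℝ≥0∞}
    (h : ∀ x ∈ A, ∀ y ∈ A, edist x y ≤ r) : eDiam (edist : X → X → ℝ≥0∞) A ≤ r :=
  iSup₂_le fun x hx => iSup₂_le fun y hy => h x hx y hy

lemma eDiam_mono {X : Type u} [MetricSpace X] {A B : Set X} (h : A ⊆ B) :
    eDiam (edist : X → X → ℝ≥0∞) A ≤ eDiam (edist : X → X → ℝ≥0∞) B :=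
  eDiam_le fun x hx y hy =>
    (le_iSup₂ (f := fun y (_ : y ∈ B) => edist x y) y (h hy)).trans
      (le_iSup₂ (f := fun x (_ : x ∈ B) => ⨆ y ∈ B, edist x y) x (h hx))

/-- Zeroth partition is trivial. -/
lemma piece_zero {X : Type u} {T : Set X} (P : Admissible T) {x : X} (hx : x ∈ T) :
    P.piece 0 x = T := by
  refine (P.subset_base 0 x hx).antisymm fun y hy => ?_
  have h := P.card_pieces 0
  have h1 : {A : Set X | ∃ x ∈ T, P.piece 0 x = A}.ncard ≤ 1 := by
    norm_num at h; omega
  have := (ncard_le_one (P.finite_pieces 0)).1 h1 _ ⟨x, hx, rfl⟩ _ ⟨y, hy, rfl⟩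
  rw [this]
  exact P.self_mem 0 y hy

lemma ediam_T {X : Type u} [MetricSpace X] (T : Set X) (r ε : ℝ≥0∞) (hε : ε ≠ 0)
    (h : entN (edist : X → X → ℝ≥0∞) 0 T ≤ r) :
    eDiam (edist : X → X → ℝ≥0∞) T ≤ 2 * (r + ε) := by
  by_cases hr : r + ε = ∞
  · rw [hr]; simp
  have hlt : entN (edist : X → X → ℝ≥0∞) 0 T < r + ε :=
    lt_of_le_of_lt h (ENNReal.lt_add_right (fun h => hr (by simp [h])) hε)
  unfold entN at hlt
  simp only [iInf_lt_iff] at hlt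
  obtain ⟨S, hS, hlt⟩ := hlt
  have hS : S.card ≤ 1 := by norm_num at hS; omega
  have hx : ∀ x ∈ T, ∃ y ∈ S, edist x y < r + ε := by
    intro x hx
    have : ⨅ y ∈ S, edist x y < r + ε := lt_of_le_of_lt (le_iSup₂ (f := fun x (_ : x ∈ T) => ⨅ y ∈ S, edist x y) x hx) hlt
    simp only [iInf_lt_iff] at this
    obtain ⟨y, hy, h⟩ := this
    exact ⟨y, hy, h⟩
  refine eDiam_le fun x hxT y hyT => ?_
  obtain ⟨u, hu, h1⟩ := hx x hxT
  obtain ⟨v, hv, h2⟩ := hx y hyT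
  have e := Finset.card_le_one.1 hS u hu v hv
  subst e
  calc edist x y ≤ edist x u + edist y u := edist_triangle_right _ _ _
    _ ≤ (r + ε) + (r + ε) := add_le_add h1.le h2.le
    _ = _ := by ring

/-- Main construction: pointwise bounds. -/
lemma main_constr {X : Type u} [MetricSpace X] (T : Set X) (s : ℕ → X → ℝ≥0) (a : ℝ≥0)
    (h : ∀ (n : ℕ) (A : Set X), A ⊆ T →
              entN (edist : X → X → ℝ≥0∞) n A ≤
                (a : ℝ≥0∞) * eDiam (edist : X → X → ℝ≥0∞) A + ⨆ x ∈ A, (s n x : ℝ≥0∞))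
    (P : Admissible T) (q S : ℝ≥0∞) (hq0 : q ≠ 0)
    (hqt : q ≠ ∞) (hS0 : S ≠ 0) (hs : ∀ n, ∀ x ∈ T, (s n x : ℝ≥0∞) ≤ S) :
    ∃ Q : Admissible T, (∀ m, ∀ x ∈ T, eDiam edist (Q.piece m x) ≤
        2 * (a * eDiam edist (P.piece 0 x) + 2 * S)) ∧
      ∀ n, ∀ x ∈ T, eDiam edist (Q.piece (n + 3) x) ≤
        2 * (a * eDiam edist (P.piece n x) + q * s n x + 2 * (q⁻¹ ^ n * S)) := by
  classical
  choose lev hlev using fun n => exists_level T n (fun x => (s n x : ℝ≥0∞)) q S hq0 hqt (hs n)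
  have hg : ∀ n, ∃ g : Set X → Fin (2 ^ 2 ^ n),
      InjOn g {A : Set X | ∃ x ∈ T, P.piece n x = A} := by
    intro n
    have : NeZero (2 ^ 2 ^ n) := ⟨by positivity⟩
    obtain ⟨g, -, hg⟩ := (P.finite_pieces n).exists_injOn_of_encard_le
      (t := (univ : Set (Fin (2 ^ 2 ^ n))))
      (by
        rw [← (P.finite_pieces n).cast_ncard_eq]
        simp
        exact_mod_cast (P.card_pieces n).le)
    exact ⟨g, hg⟩
  choose g hg using hg
  have hε : ∀ n, q⁻¹ ^ n * S ≠ 0 := fun n =>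
    mul_ne_zero (pow_ne_zero _ (ENNReal.inv_ne_zero.2 hqt)) hS0
  have hF : ∀ n (A : Set X), ∃ f : X → Fin (2 ^ 2 ^ n), A ⊆ T → ∀ x ∈ A, ∀ y ∈ A, f x = f y →
      edist x y ≤ 2 * ((a * eDiam edist A + ⨆ x ∈ A, (s n x : ℝ≥0∞)) + q⁻¹ ^ n * S) := by
    intro n A
    have : NeZero (2 ^ 2 ^ n) := ⟨by positivity⟩
    by_cases hA : A ⊆ T
    · obtain ⟨f, hf⟩ := exists_label n A _ _ (hε n) (h n A hA)
      exact ⟨f, fun _ => hf⟩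
    · exact ⟨fun _ => 0, fun h => absurd h hA⟩
  choose F hF using hF
  let B : ℕ → X → Set X := fun n x => {y ∈ T | P.piece n y = P.piece n x ∧ lev n y = lev n x}
  obtain ⟨Q, hQ⟩ := exists_adm T (fun n x => (g n (P.piece n x), lev n x, F n (B n x) x))
  refine ⟨Q, fun m x hx => ?_, fun n x hx => ?_⟩
  · rw [piece_zero P hx]
    refine (eDiam_mono (Q.subset_base m x hx)).trans ?_
    refine (ediam_T T _ S hS0 (h 0 T subset_rfl)).trans ?_
    have : (⨆ x ∈ T, (s 0 x : ℝ≥0∞)) ≤ S := iSup₂_le (hs 0)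
    rw [two_mul S, ← add_assoc]
    gcongr
  · have hB : B n x ⊆ T := fun y hy => hy.1
    have hsub : ∀ y ∈ Q.piece (n + 3) x, y ∈ B n x ∧ F n (B n x) y = F n (B n x) x := by
      intro y hy
      rw [hQ] at hy
      obtain ⟨hyT, hy⟩ := hy
      have := hy n le_rfl
      simp only [Prod.mk.injEq] at this
      obtain ⟨h1, h2, h3⟩ := this
      have h1 := hg n ⟨y, hyT, rfl⟩ ⟨x, hx, rfl⟩ h1
      have e : B n y = B n x := by
        simp only [B, h1, h2]
      rw [e] at h3
      exact ⟨⟨hyT, h1, h2⟩, h3⟩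
    have hd : eDiam edist (B n x) ≤ eDiam edist (P.piece n x) :=
      eDiam_mono fun y hy => by
        rw [← hy.2.1]; exact P.self_mem n y hy.1
    have hsup : (⨆ y ∈ B n x, (s n y : ℝ≥0∞)) ≤ q * s n x + q⁻¹ ^ n * S :=
      iSup₂_le fun y hy => hlev n x hx y hy.1 hy.2.2.symm
    refine eDiam_le fun y hy z hz => ?_
    refine (hF n (B n x) hB y (hsub y hy).1 z (hsub z hz).1
      ((hsub y hy).2.trans (hsub z hz).2.symm)).trans ?_
    calc 2 * ((a * eDiam edist (B n x) + ⨆ y ∈ B n x, (s n y : ℝ≥0∞)) + q⁻¹ ^ n * S)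
        ≤ 2 * ((a * eDiam edist (P.piece n x) + (q * s n x + q⁻¹ ^ n * S)) + q⁻¹ ^ n * S) := by
          gcongr
      _ = _ := by ring

lemma add3_rpow_le (x y z : ℝ≥0∞) (p : ℝ) (hp : 1 ≤ p) :
    (x + y + z) ^ p ≤ 3 ^ p * (x ^ p + y ^ p + z ^ p) := by
  have hp0 : 0 ≤ p := by linarith
  have key : ∀ m : ℝ≥0∞, x ≤ m → y ≤ m → z ≤ m → (x + y + z) ^ p ≤ 3 ^ p * m ^ p := by
    intro m hx hy hz
    rw [← ENNReal.mul_rpow_of_nonneg _ _ hp0]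
    refine ENNReal.rpow_le_rpow ?_ hp0
    calc x + y + z ≤ m + m + m := by gcongr
      _ = 3 * m := by ring
  rcases le_total x y with h1 | h1 <;> rcases le_total y z with h2 | h2 <;>
    rcases le_total x z with h3 | h3
  · exact (key z h3 h2 le_rfl).trans (by gcongr; exact le_add_self)
  · exact (key z (h1.trans h2) h2 le_rfl).trans (by gcongr; exact le_add_self)
  · exact (key y h1 le_rfl h2).trans (by gcongr; exact le_add_self.trans le_self_add)
  · exact (key y h1 le_rfl h2).trans (by gcongr; exact le_add_self.trans le_self_add)
  · exact (key z h3 h2 le_rfl).trans (by gcongr; exact le_add_self)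
  · exact (key x le_rfl h1 h3).trans (by gcongr; rw [add_assoc]; exact le_self_add)
  · exact (key x le_rfl h1 (h2.trans h1)).trans (by gcongr; rw [add_assoc]; exact le_self_add)
  · exact (key x le_rfl h1 h3).trans (by gcongr; rw [add_assoc]; exact le_self_add)

lemma sum_bound (p : ℝ) (hp : 1 ≤ p) (b a V S : ℝ≥0∞) (hb : 1 ≤ b) (hbt : b ≠ ∞)
    (D d s : ℕ → ℝ≥0∞)
    (hD0 : ∀ m, D m ≤ 2 * (a * d 0 + 2 * S))
    (hD : ∀ n, D (n + 3) ≤ 2 * (a * d n + b ^ 2 * s n + 2 * ((b ^ 2)⁻¹ ^ n * S)))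
    (hs : ∑' n, (b ^ n * s n) ^ p ≤ S ^ p) (hd : ∑' n, (b ^ n * d n) ^ p ≤ V ^ p) :
    ∑' n, (b ^ n * D n) ^ p ≤ 6 * (12 * b ^ 5 * (1 - b⁻¹)⁻¹ * (a * V + S)) ^ p := by
  have hp0 : 0 ≤ p := by linarith
  have hp1 : 0 < p := by linarith
  have hb0 : b ≠ 0 := (zero_lt_one.trans_le hb).ne'
  set W := (1 - b⁻¹)⁻¹ with hW
  have hW1 : 1 ≤ W := by
    rw [hW, ENNReal.one_le_inv]; exact tsub_le_self
  set B := a * V + S with hB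
  set R := (12 * b ^ 5 * W * B) ^ p with hR
  have hd0 : d 0 ≤ V := by
    have h1 := (ENNReal.le_tsum (f := fun n => (b ^ n * d n) ^ p) 0).trans hd
    rw [ENNReal.rpow_le_rpow_iff hp1] at h1
    simpa using h1
  have hfirst : ∀ m < 3, (b ^ m * D m) ^ p ≤ R := by
    intro m hm
    refine ENNReal.rpow_le_rpow ?_ hp0
    calc b ^ m * D m ≤ b ^ 5 * (2 * (2 * B)) := by
          gcongr
          · omega
          · refine (hD0 m).trans ?_
            rw [hB, mul_add 2 (a * V) S]
            refine mul_le_mul_right (add_le_add_left ?_ _) _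
            calc a * d 0 ≤ a * V := by gcongr
              _ ≤ 2 * (a * V) := le_mul_of_one_le_left' (by norm_num)
      _ = 4 * b ^ 5 * 1 * B := by ring
      _ ≤ 12 * b ^ 5 * W * B := by gcongr; norm_num
  have hterm : ∀ n, (b ^ (n + 3) * D (n + 3)) ^ p ≤
      (6 * b ^ 3) ^ p * (a ^ p * (b ^ n * d n) ^ p + (b ^ 2) ^ p * (b ^ n * s n) ^ p +
        (2 * S) ^ p * b⁻¹ ^ n) := by
    intro n
    have e1 : b ^ n * (b ^ 2)⁻¹ ^ n = b⁻¹ ^ n := by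
      rw [← mul_pow]
      congr 1
      rw [sq, ENNReal.mul_inv (Or.inl hb0) (Or.inl hbt), ← mul_assoc, ENNReal.mul_inv_cancel hb0 hbt,
        one_mul]
    have h1 : b ^ (n + 3) * D (n + 3) ≤ 2 * b ^ 3 *
        (a * (b ^ n * d n) + b ^ 2 * (b ^ n * s n) + 2 * S * b⁻¹ ^ n) := by
      calc b ^ (n + 3) * D (n + 3) ≤ b ^ (n + 3) * (2 * (a * d n + b ^ 2 * s n + 2 * ((b ^ 2)⁻¹ ^ n * S))) := by
            gcongr; exact hD n
        _ = 2 * b ^ 3 * (a * (b ^ n * d n) + b ^ 2 * (b ^ n * s n) +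
              2 * S * (b ^ n * (b ^ 2)⁻¹ ^ n)) := by ring
        _ = _ := by rw [e1]
    have h2 : (b⁻¹ ^ n) ^ p ≤ b⁻¹ ^ n := by
      have hle : b⁻¹ ^ n ≤ 1 := pow_le_one' (ENNReal.inv_le_one.2 hb) n
      calc (b⁻¹ ^ n) ^ p ≤ (b⁻¹ ^ n) ^ (1 : ℝ) := ENNReal.rpow_le_rpow_of_exponent_ge hle hp
        _ = _ := ENNReal.rpow_one _
    calc _ ≤ _ := ENNReal.rpow_le_rpow h1 hp0
      _ ≤ (2 * b ^ 3) ^ p * (3 ^ p * _) := by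
        rw [ENNReal.mul_rpow_of_nonneg _ _ hp0]
        gcongr
        exact add3_rpow_le _ _ _ p hp
      _ = (6 * b ^ 3) ^ p * (a ^ p * (b ^ n * d n) ^ p + (b ^ 2) ^ p * (b ^ n * s n) ^ p +
        (2 * S) ^ p * (b⁻¹ ^ n) ^ p) := by
        rw [← mul_assoc, ← ENNReal.mul_rpow_of_nonneg _ _ hp0,
          ← ENNReal.mul_rpow_of_nonneg a _ hp0, ← ENNReal.mul_rpow_of_nonneg (b ^ 2) _ hp0,
          ← ENNReal.mul_rpow_of_nonneg (2 * S) _ hp0]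
        congr 2
        ring
      _ ≤ _ := by gcongr
  have htail : ∑' n, (b ^ (n + 3) * D (n + 3)) ^ p ≤ 3 * R := by
    refine (ENNReal.tsum_le_tsum hterm).trans ?_
    rw [ENNReal.tsum_mul_left, ENNReal.tsum_add, ENNReal.tsum_add, ENNReal.tsum_mul_left,
      ENNReal.tsum_mul_left, ENNReal.tsum_mul_left, ENNReal.tsum_geometric]
    have hWp : W ≤ W ^ p := by
      calc W = W ^ (1 : ℝ) := (ENNReal.rpow_one _).symm
        _ ≤ W ^ p := ENNReal.rpow_le_rpow_of_exponent_le hW1 hp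
    have hb2 : 1 ≤ b ^ 2 := one_le_pow₀ hb
    set G := 2 * b ^ 2 * W * B with hG
    have k1 : a ^ p * ∑' n, (b ^ n * d n) ^ p ≤ G ^ p := by
      calc _ ≤ a ^ p * V ^ p := by gcongr
        _ = (1 * 1 * 1 * (a * V)) ^ p := by rw [← ENNReal.mul_rpow_of_nonneg _ _ hp0]; simp
        _ ≤ G ^ p := by
          rw [hG, hB]
          gcongr
          · norm_num
          · exact le_self_add
    have k2 : (b ^ 2) ^ p * ∑' n, (b ^ n * s n) ^ p ≤ G ^ p := by
      calc _ ≤ (b ^ 2) ^ p * S ^ p := by gcongr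
        _ = (1 * b ^ 2 * 1 * S) ^ p := by rw [← ENNReal.mul_rpow_of_nonneg _ _ hp0]; simp
        _ ≤ G ^ p := by
          rw [hG, hB]
          gcongr
          · norm_num
          · exact le_add_self
    have k3 : (2 * S) ^ p * W ≤ G ^ p := by
      calc _ ≤ (2 * S) ^ p * W ^ p := by gcongr
        _ = (2 * 1 * W * S) ^ p := by
          rw [← ENNReal.mul_rpow_of_nonneg _ _ hp0]; congr 1; ring
        _ ≤ G ^ p := by
          rw [hG, hB]
          gcongr
          exact le_add_self
    calc _ ≤ (6 * b ^ 3) ^ p * (G ^ p + G ^ p + G ^ p) := by gcongr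
      _ = 3 * ((6 * b ^ 3) ^ p * G ^ p) := by ring
      _ = 3 * R := by
        rw [← ENNReal.mul_rpow_of_nonneg _ _ hp0, hR, hG]
        congr 2
        ring
  rw [← Summable.sum_add_tsum_nat_add' (f := fun n => (b ^ n * D n) ^ p) (k := 3) ENNReal.summable]
  calc _ ≤ (∑ i ∈ Finset.range 3, R) + 3 * R := by
        gcongr with i hi
        exact hfirst i (Finset.mem_range.1 hi)
    _ = 6 * R := by simp; ring

/-- **The contraction principle** (Theorem 2.1).
If `e_n(A) ≤ a·diam(A) + sup_{x∈A} s_n(x)` for every `n ≥ 0` and `A ⊆ T`, then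
`γ_{α,p}(T) ≤ C (a·γ_{α,p}(T) + [sup_{x∈T} Σ_n (2^{n/α} s_n(x))^p]^{1/p})`,
where `C` depends only on `α`. -/
theorem contraction_principle (α : ℝ) (hα : 0 < α) :
    ∃ C : ℝ≥0∞, 0 < C ∧ C ≠ ∞ ∧
      ∀ (X : Type u) [MetricSpace X] (T : Set X) (p : ℝ), 1 ≤ p →
        ∀ (s : ℕ → X → ℝ≥0) (a : ℝ≥0),
          (∀ (n : ℕ) (A : Set X), A ⊆ T →
              entN (edist : X → X → ℝ≥0∞) n A ≤
                (a : ℝ≥0∞) * eDiam (edist : X → X → ℝ≥0∞) A + ⨆ x ∈ A, (s n x : ℝ≥0∞)) →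
          gammaF (edist : X → X → ℝ≥0∞) α p T ≤
            C * ((a : ℝ≥0∞) * gammaF (edist : X → X → ℝ≥0∞) α p T +
              (⨆ x ∈ T, ∑' n : ℕ, ((2 : ℝ≥0∞) ^ ((n : ℝ) / α) * (s n x : ℝ≥0∞)) ^ p) ^ p⁻¹) := by
  classical
  set b : ℝ≥0∞ := (2 : ℝ≥0∞) ^ (1 / α) with hbdef
  have hα1 : 0 < 1 / α := by positivity
  have hb1 : 1 < b := ENNReal.one_lt_rpow (by norm_num) hα1
  have hbt : b ≠ ∞ := ENNReal.rpow_ne_top_of_nonneg hα1.le (by norm_num)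
  have hb0 : b ≠ 0 := (zero_lt_one.trans hb1).ne'
  have hpow : ∀ n : ℕ, (2 : ℝ≥0∞) ^ ((n : ℝ) / α) = b ^ n := by
    intro n
    rw [hbdef, ← ENNReal.rpow_natCast, ← ENNReal.rpow_mul]
    congr 1
    ring
  have hw : b⁻¹ < 1 := ENNReal.inv_lt_one.2 hb1
  have hw0 : 1 - b⁻¹ ≠ 0 := (tsub_pos_of_lt hw).ne'
  have hwt : 1 - b⁻¹ ≠ ∞ := (lt_of_le_of_lt tsub_le_self ENNReal.one_lt_top).ne
  set C : ℝ≥0∞ := 6 * (12 * b ^ 5 * (1 - b⁻¹)⁻¹) with hC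
  have hC0 : C ≠ 0 := by
    rw [hC]
    refine mul_ne_zero (by norm_num) (mul_ne_zero (mul_ne_zero (by norm_num) (pow_ne_zero _ hb0)) ?_)
    exact ENNReal.inv_ne_zero.2 hwt
  have hCt : C ≠ ∞ := by
    rw [hC]
    refine ENNReal.mul_ne_top (by norm_num) (ENNReal.mul_ne_top (ENNReal.mul_ne_top (by norm_num) (ENNReal.pow_ne_top hbt)) ?_)
    exact ENNReal.inv_ne_top.2 hw0
  refine ⟨C, pos_iff_ne_zero.2 hC0, hCt, ?_⟩
  intro X _ T p hp s a h
  have hp0 : 0 < p := by linarith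
  have hpi : 0 ≤ p⁻¹ := by positivity
  simp only [hpow]
  set S := (⨆ x ∈ T, ∑' n : ℕ, (b ^ n * (s n x : ℝ≥0∞)) ^ p) ^ p⁻¹ with hS
  -- bound for a given admissible sequence
  have main : ∀ P : Admissible T, gammaF (edist : X → X → ℝ≥0∞) α p T ≤
      C * (a * (⨆ x ∈ T, ∑' n : ℕ, (b ^ n * eDiam edist (P.piece n x)) ^ p) ^ p⁻¹ + S) := by
    intro P
    set V := (⨆ x ∈ T, ∑' n : ℕ, (b ^ n * eDiam edist (P.piece n x)) ^ p) ^ p⁻¹ with hV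
    rw [mul_comm C, ← ENNReal.div_le_iff hC0 hCt]
    refine ENNReal.le_of_forall_pos_le_add fun ε hε _ => ?_
    rw [ENNReal.div_le_iff hC0 hCt]
    set Seps : ℝ≥0∞ := S + ε with hSeps
    have hSne : Seps ≠ 0 := by
      rw [hSeps]; simp [hε.ne']
    have hsum : ∀ x ∈ T, ∑' n : ℕ, (b ^ n * (s n x : ℝ≥0∞)) ^ p ≤ Seps ^ p := by
      intro x hx
      calc _ ≤ (⨆ x ∈ T, ∑' n : ℕ, (b ^ n * (s n x : ℝ≥0∞)) ^ p) :=
            le_iSup₂ (f := fun x (_ : x ∈ T) => ∑' n : ℕ, (b ^ n * (s n x : ℝ≥0∞)) ^ p) x hx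
        _ = S ^ p := by rw [hS, ENNReal.rpow_inv_rpow hp0.ne']
        _ ≤ Seps ^ p := by
          rw [hSeps]; gcongr; exact le_self_add
    have hdsum : ∀ x ∈ T, ∑' n : ℕ, (b ^ n * eDiam edist (P.piece n x)) ^ p ≤ V ^ p := by
      intro x hx
      rw [hV, ENNReal.rpow_inv_rpow hp0.ne']
      exact le_iSup₂ (f := fun x (_ : x ∈ T) => ∑' n : ℕ, (b ^ n * eDiam edist (P.piece n x)) ^ p) x hx
    have hs : ∀ n, ∀ x ∈ T, (s n x : ℝ≥0∞) ≤ Seps := by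
      intro n x hx
      have h1 := (ENNReal.le_tsum (f := fun n => (b ^ n * (s n x : ℝ≥0∞)) ^ p) n).trans (hsum x hx)
      rw [ENNReal.rpow_le_rpow_iff hp0] at h1
      exact le_trans (le_mul_of_one_le_left' (one_le_pow₀ hb1.le)) h1
    obtain ⟨Q, hQ0, hQ⟩ := main_constr T s a h P (b ^ 2) Seps (pow_ne_zero _ hb0)
      (ENNReal.pow_ne_top hbt) hSne hs
    refine (iInf_le _ Q).trans ?_
    simp only [hpow]
    have h6 : (6 : ℝ≥0∞) ≤ 6 ^ p := by
      calc (6 : ℝ≥0∞) = 6 ^ (1 : ℝ) := (ENNReal.rpow_one _).symm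
        _ ≤ 6 ^ p := ENNReal.rpow_le_rpow_of_exponent_le (by norm_num) hp
    rw [ENNReal.rpow_inv_le_iff hp0]
    refine iSup₂_le fun x hx => ?_
    refine (sum_bound p hp b a V Seps hb1.le hbt _ (fun n => eDiam edist (P.piece n x))
      (fun n => (s n x : ℝ≥0∞)) (fun m => hQ0 m x hx) (fun n => hQ n x hx) (hsum x hx)
      (hdsum x hx)).trans ?_
    refine (mul_le_mul_left h6 _).trans ?_
    rw [← ENNReal.mul_rpow_of_nonneg _ _ hp0.le]
    refine le_of_eq ?_
    congr 1
    rw [hSeps, hC]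
    ring
  obtain ⟨P₀, -⟩ := exists_adm T (fun k _ => (⟨0, by positivity⟩, ⟨0, by positivity⟩, ⟨0, by positivity⟩))
  by_cases ha : (a : ℝ≥0∞) = 0
  · have := main P₀
    rw [ha] at this ⊢
    simpa using this
  · have : Nonempty (Admissible T) := ⟨P₀⟩
    rw [mul_comm C, ← ENNReal.div_le_iff hC0 hCt]
    conv_rhs => rw [gammaF, ENNReal.mul_iInf_of_ne ha ENNReal.coe_ne_top, ENNReal.iInf_add]
    refine le_iInf fun P => ?_
    simp only [hpow]
    rw [ENNReal.div_le_iff hC0 hCt, mul_comm _ C]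
    exact main P
end
end

section
/- (Sharpness of the Sudakov bound for the ℓ¹-ball.) Let ‖·‖ be a norm on ℝ^d that is 1-unconditional with respect to the standard basis (i.e., ‖(ε₁x₁,…,ε_d x_d)‖ = ‖x‖ for all signs ε_i ∈ {±1}), let d(x,y) = ‖x−y‖, and let B₁^d be the unit ℓ¹-ball in ℝ^d. Then for every α > 0 there are constants c, C > 0 depending only on α such that c · sup_{n≥0} 2^{n/α} e_n(B₁^d) ≤ γ_α(B₁^d) ≤ C · sup_{n≥0} 2^{n/α} e_n(B₁^d). -/
open scoped ENNReal NNReal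
open EMetric Set

noncomputable section

universe u

/-- Bundled hypotheses: a 1-unconditional norm. -/
structure UNorm (d : ℕ) (N : (Fin d → ℝ) → ℝ) : Prop where
  nonneg : ∀ x, 0 ≤ N x
  eq_zero : ∀ x, N x = 0 ↔ x = 0
  smul : ∀ (t : ℝ) (x), N (t • x) = |t| * N x
  add_le : ∀ x y, N (x + y) ≤ N x + N y
  uncond : ∀ (ε : Fin d → ℝ) (x), (∀ i, ε i = 1 ∨ ε i = -1) →
          N (fun i => ε i * x i) = N x

/-- The unit ball of ℓ¹. -/
def B1 (d : ℕ) : Set (Fin d → ℝ) := {x | ∑ i, |x i| ≤ 1}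

/-- The ℓ¹ norm. -/
def n1 {d : ℕ} (x : Fin d → ℝ) : ℝ := ∑ i, |x i|

namespace UNorm

variable {d : ℕ} {N : (Fin d → ℝ) → ℝ}

lemma zero (h : UNorm d N) : N 0 = 0 := (h.eq_zero 0).2 rfl

lemma neg (h : UNorm d N) (x) : N (-x) = N x := by
  have := h.smul (-1) x
  simpa using this

lemma sub_comm (h : UNorm d N) (x y) : N (x - y) = N (y - x) := by
  rw [← h.neg, neg_sub]

lemma tri (h : UNorm d N) (x y z) : N (x - z) ≤ N (x - y) + N (y - z) := by
  have := h.add_le (x - y) (y - z)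
  simpa using this

lemma mono (h : UNorm d N) (x y : Fin d → ℝ) (hxy : ∀ i, |x i| ≤ |y i|) : N x ≤ N y := by
  have key : ∀ S : Finset (Fin d), N (fun i => if i ∈ S then x i else y i) ≤ N y := by
    intro S
    induction S using Finset.induction_on with
    | empty => simp
    | insert j S hj ih =>
      refine le_trans ?_ ih
      obtain ⟨l, hl1, hl⟩ : ∃ l : ℝ, |l| ≤ 1 ∧ x j = l * y j := by
        by_cases hy : y j = 0
        · refine ⟨0, by simp, ?_⟩
          have := hxy j
          rw [hy] at this
          simpa using this
        · refine ⟨x j / y j, ?_, by field_simp⟩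
          rw [abs_div]
          exact div_le_one_of_le₀ (hxy j) (abs_nonneg _)
      obtain ⟨h1, h2⟩ := abs_le.1 hl1
      set z : Fin d → ℝ := fun i => if i ∈ S then x i else y i with hz
      have e : (fun i => if i ∈ insert j S then x i else y i) =
          ((1 + l) / 2) • z + ((1 - l) / 2) • (fun i => (if i = j then (-1 : ℝ) else 1) * z i) := by
        funext i
        by_cases hij : i = j
        · subst hij
          simp [hz, hj, hl]
          ring
        · by_cases hiS : i ∈ S <;> simp [hz, hij, hiS] <;> ring
      rw [e]
      refine (h.add_le _ _).trans ?_
      rw [h.smul, h.smul, h.uncond _ z (by intro i; by_cases hij : i = j <;> simp [hij]),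
        abs_of_nonneg (by linarith), abs_of_nonneg (by linarith)]
      apply le_of_eq
      ring
  simpa using key Finset.univ

lemma cont (h : UNorm d N) : Continuous N := by
  have hc : ConvexOn ℝ Set.univ N := by
    refine ⟨convex_univ, ?_⟩
    intro x _ y _ a b ha hb _
    refine (h.add_le _ _).trans ?_
    rw [h.smul, h.smul, abs_of_nonneg ha, abs_of_nonneg hb]
    simp
  exact continuousOn_univ.1 (hc.continuousOn isOpen_univ)

lemma B1_compact : IsCompact (B1 d) := by
  apply Metric.isCompact_of_isClosed_isBounded
  · exact isClosed_le (by fun_prop) continuous_const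
  · refine (Metric.isBounded_closedBall (x := (0 : Fin d → ℝ)) (r := 1)).subset ?_
    intro x hx
    rw [mem_closedBall_zero_iff, pi_norm_le_iff_of_nonneg zero_le_one]
    intro i
    rw [Real.norm_eq_abs]
    exact (Finset.single_le_sum (f := fun i => |x i|) (fun i _ => abs_nonneg _)
      (Finset.mem_univ i)).trans hx

/-- Existence of the interpolation minimizers. -/
lemma exists_min (h : UNorm d N) (t : ℝ) (x : Fin d → ℝ) :
    ∃ y ∈ B1 d, ∀ z ∈ B1 d, n1 y + t * N (x - y) ≤ n1 z + t * N (x - z) := by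
  have hc := h.cont
  obtain ⟨y, hy, hm⟩ := (B1_compact (d := d)).exists_isMinOn ⟨0, by simp [B1]⟩
    (f := fun y => n1 y + t * N (x - y))
    (by unfold n1; fun_prop)
  exact ⟨y, hy, fun z hz => hm hz⟩

/-- The coordinatewise minimum of two vectors. -/
lemma exists_cmin (y z : ℝ) : ∃ w : ℝ, |y - w| ≤ |y - z| ∧ |z - w| ≤ |y - z| ∧
    |y - w| + |w| = |y| ∧ |z - w| + |w| = |z| := by
  rcases le_total 0 y with hy | hy <;> rcases le_total 0 z with hz | hz
  · rcases le_total y z with hh | hh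
    · exact ⟨y, by simp, by rw [abs_sub_comm], by simp, by
        rw [abs_of_nonneg hy, abs_of_nonneg hz, abs_of_nonneg (by linarith)]; ring⟩
    · exact ⟨z, by simp, by simp, by
        rw [abs_of_nonneg hy, abs_of_nonneg hz, abs_of_nonneg (by linarith)]; ring, by simp⟩
  · refine ⟨0, ?_, ?_, by simp, by simp⟩ <;>
    rw [abs_of_nonneg (show 0 ≤ y - z by linarith)] <;> rw [abs_le] <;> constructor <;> linarith
  · refine ⟨0, ?_, ?_, by simp, by simp⟩ <;>
    rw [abs_of_nonpos (show y - z ≤ 0 by linarith)] <;> rw [abs_le] <;> constructor <;> linarith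
  · rcases le_total y z with hh | hh
    · exact ⟨z, by simp, by simp, by
        rw [abs_of_nonpos hy, abs_of_nonpos hz, abs_of_nonpos (by linarith)]; ring, by simp⟩
    · exact ⟨y, by simp, by rw [abs_sub_comm], by simp, by
        rw [abs_of_nonpos hy, abs_of_nonpos hz, abs_of_nonpos (by linarith)]; ring⟩

/-- Key lemma: minimizers have ℓ¹ distance controlled by the norm distance. -/
lemma key (h : UNorm d N) {t : ℝ} (ht : 0 ≤ t) {x x' y y' : Fin d → ℝ}
    (hy : y ∈ B1 d)
    (hm : ∀ z ∈ B1 d, n1 y + t * N (x - y) ≤ n1 z + t * N (x - z))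
    (hm' : ∀ z ∈ B1 d, n1 y' + t * N (x' - y') ≤ n1 z + t * N (x' - z)) :
    n1 (y - y') ≤ 2 * t * N (y - y') := by
  choose w h1 h2 h3 h4 using fun i => exists_cmin (y i) (y' i)
  have hw : n1 (y - w) + n1 w = n1 y := by
    simp only [n1, Pi.sub_apply, ← Finset.sum_add_distrib, h3]
  have hw' : n1 (y' - w) + n1 w = n1 y' := by
    simp only [n1, Pi.sub_apply, ← Finset.sum_add_distrib, h4]
  have hp : 0 ≤ n1 (y - w) := Finset.sum_nonneg fun i _ => abs_nonneg _
  have hwB : w ∈ B1 d := by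
    have : n1 y ≤ 1 := hy
    show n1 w ≤ 1
    linarith
  have a1 := hm w hwB
  have a2 := hm' w hwB
  have b1 := mul_le_mul_of_nonneg_left (h.tri x y w) ht
  have b2 := mul_le_mul_of_nonneg_left (h.tri x' y' w) ht
  have c1 := mul_le_mul_of_nonneg_left (h.mono (y - w) (y - y') (by simpa using h1)) ht
  have c2 := mul_le_mul_of_nonneg_left (h.mono (y' - w) (y - y') (by simpa using h2)) ht
  have : n1 (y - y') ≤ n1 (y - w) + n1 (y' - w) := by
    simp only [n1, ← Finset.sum_add_distrib]
    refine Finset.sum_le_sum fun i _ => ?_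
    simp only [Pi.sub_apply]
    have := abs_sub_le (y i) (w i) (y' i)
    rwa [abs_sub_comm (w i)] at this
  linarith

/-- Interpolation lemma, finite form. -/
lemma interp (h : UNorm d N) {a r : ℝ} (ha : 0 < a) (hr : 1 < r) {x : Fin d → ℝ} (hx : x ∈ B1 d)
    (p : ℕ → (Fin d → ℝ)) (hp : ∀ n, p n ∈ B1 d)
    (hm : ∀ n, ∀ z ∈ B1 d, n1 (p n) + a * r ^ n * N (x - p n) ≤ n1 z + a * r ^ n * N (x - z))
    (M : ℕ) :
    ∑ n ∈ Finset.range M, r ^ n * N (x - p n) ≤ r / (a * (r - 1)) := by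
  have n1nn : ∀ z : Fin d → ℝ, 0 ≤ n1 z := fun z => Finset.sum_nonneg fun i _ => abs_nonneg _
  have hr0 : 0 < r := by linarith
  have step : ∀ M : ℕ, (a * (r - 1) / r) * ∑ n ∈ Finset.range (M + 1), r ^ n * N (x - p n) ≤
      n1 (p M) + a * r ^ M * N (x - p M) := by
    intro M
    induction M with
    | zero =>
      simp only [zero_add, Finset.sum_range_one, pow_zero, one_mul, mul_one]
      have h1 : a * (r - 1) / r ≤ a := by
        rw [div_le_iff₀ hr0]; nlinarith
      have := mul_le_mul_of_nonneg_right h1 (h.nonneg (x - p 0))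
      linarith [n1nn (p 0)]
    | succ M ih =>
      rw [Finset.sum_range_succ, mul_add]
      have h1 := hm M (p (M + 1)) (hp _)
      have h2 : a * (r - 1) / r * (r ^ (M + 1) * N (x - p (M + 1))) =
        a * r ^ (M + 1) * N (x - p (M + 1)) - a * r ^ M * N (x - p (M + 1)) := by
        field_simp
        ring
      linarith
  cases M with
  | zero =>
    simp only [Finset.range_zero, Finset.sum_empty]
    have : 0 < r - 1 := by linarith
    positivity
  | succ M =>
    have h1 := (step M).trans (hm M x hx)
    have hx1 : n1 x ≤ 1 := hx
    rw [sub_self, h.zero, mul_zero, add_zero] at h1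
    have h3 : 0 < r - 1 := by linarith
    rw [le_div_iff₀ (by positivity)]
    have h4 := h1.trans hx1
    rw [div_mul_eq_mul_div, div_le_one hr0] at h4
    linarith

end UNorm

lemma decode {k a b a' b' : ℕ} (hb : b < k) (hb' : b' < k) (h : a * k + b = a' * k + b') :
    a = a' ∧ b = b' := by
  have hk : 0 < k := by omega
  have h1 : (a * k + b) / k = a := by
    rw [mul_comm, Nat.mul_add_div hk, Nat.div_eq_of_lt hb]; rfl
  have h2 : (a' * k + b') / k = a' := by
    rw [mul_comm, Nat.mul_add_div hk, Nat.div_eq_of_lt hb']; rfl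
  have : a = a' := by rw [← h1, ← h2, h]
  subst this
  exact ⟨rfl, by omega⟩

lemma encode_lt {k a b M : ℕ} (hb : b < k) (ha : a < M) : a * k + b < M * k := by
  have : (a + 1) * k ≤ M * k := Nat.mul_le_mul_right k ha
  rw [add_mul] at this
  omega

lemma exists_index {X : Type*} (S : Finset X) :
    ∃ e : X → ℕ, (∀ v ∈ S, e v < S.card) ∧ ∀ v ∈ S, ∀ w ∈ S, e v = e w → v = w := by
  classical
  refine ⟨fun v => if hv : v ∈ S then (S.equivFin ⟨v, hv⟩ : ℕ) else 0, ?_, ?_⟩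
  · intro v hv
    simp only [hv, dif_pos]
    exact (S.equivFin ⟨v, hv⟩).2
  · intro v hv w hw hvw
    simp only [hv, hw, dif_pos] at hvw
    have := S.equivFin.injective (Fin.ext hvw)
    simpa using this

namespace UNorm

variable {d : ℕ} {N : (Fin d → ℝ) → ℝ}

/-- A net of the unit ball gives a net of every dilate. -/
lemma net_scale (h : UNorm d N) {ε : ℝ} (S : Finset (Fin d → ℝ))
    (hS : ∀ u ∈ B1 d, ∃ v ∈ S, N (u - v) ≤ ε) {R : ℝ} (hR : 0 ≤ R) (u : Fin d → ℝ)
    (hu : n1 u ≤ R) : ∃ v ∈ S, N (u - R • v) ≤ R * ε := by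
  rcases hR.eq_or_lt with h0 | h0
  · subst h0
    obtain ⟨v, hv, _⟩ := hS 0 (by simp [B1])
    refine ⟨v, hv, ?_⟩
    have : u = 0 := by
      have h1 : ∑ i, |u i| = 0 := le_antisymm hu (Finset.sum_nonneg fun i _ => abs_nonneg _)
      rw [Finset.sum_eq_zero_iff_of_nonneg (fun i _ => abs_nonneg _)] at h1
      funext i
      simpa using h1 i (Finset.mem_univ i)
    simp [this, h.zero]
  · obtain ⟨v, hv, hvN⟩ := hS (R⁻¹ • u) (by
      show ∑ i, |(R⁻¹ • u) i| ≤ 1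
      simp only [Pi.smul_apply, smul_eq_mul, abs_mul, ← Finset.mul_sum]
      rw [abs_of_pos (inv_pos.2 h0), inv_mul_le_iff₀ h0, mul_one]
      exact hu)
    refine ⟨v, hv, ?_⟩
    have e : u - R • v = R • (R⁻¹ • u - v) := by
      rw [smul_sub, smul_inv_smul₀ h0.ne']
    rw [e, h.smul, abs_of_pos h0]
    exact mul_le_mul_of_nonneg_left hvN hR

/-- One refinement step of the contraction principle. -/
lemma refine_step (h : UNorm d N) {t ε θ Δ : ℝ} (ht : 0 ≤ t) (S : Finset (Fin d → ℝ))
    (hS : ∀ u ∈ B1 d, ∃ v ∈ S, N (u - v) ≤ ε) (hθ : 4 * t * ε = θ) (hθ0 : 0 ≤ θ) (hθ1 : θ ≤ 1)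
    (p : (Fin d → ℝ) → (Fin d → ℝ)) (hp : ∀ x, p x ∈ B1 d)
    (hm : ∀ x, ∀ z ∈ B1 d, n1 (p x) + t * N (x - p x) ≤ n1 z + t * N (x - z))
    (hΔ0 : 0 < Δ) (hΔ : ∀ x ∈ B1 d, ∀ y ∈ B1 d, N (x - y) ≤ Δ)
    {B m M : ℕ} (hB : 0 < B) (hSm : S.card ≤ m) (f : (Fin d → ℝ) → ℕ)
    (hf : ∀ x ∈ B1 d, f x < M) :
    ∃ g : (Fin d → ℝ) → ℕ, (∀ x ∈ B1 d, g x < M * ((B + 1) * m)) ∧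
      (∀ x ∈ B1 d, ∀ y ∈ B1 d, g x = g y → f x = f y) ∧
      ∀ x ∈ B1 d, ∀ δ : ℝ,
        (∀ y ∈ B1 d, ∀ z ∈ B1 d, f y = f x → f z = f x → N (y - z) ≤ δ) →
        ∀ y ∈ B1 d, ∀ z ∈ B1 d, g y = g x → g z = g x →
          N (y - z) ≤ θ * δ + 4 * N (x - p x) + 5 * (Δ / B) := by
  classical
  have hBr : (0 : ℝ) < B := by exact_mod_cast hB
  set s : (Fin d → ℝ) → ℝ := fun x => N (x - p x) with hs
  have hs0 : ∀ x, 0 ≤ s x := fun x => h.nonneg _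
  set b : (Fin d → ℝ) → ℕ := fun x => ⌊s x * B / Δ⌋₊ with hb
  have hbB : ∀ x ∈ B1 d, b x < B + 1 := by
    intro x hx
    rw [Nat.lt_succ_iff]
    apply Nat.floor_le_of_le
    rw [div_le_iff₀ hΔ0, mul_comm]
    exact mul_le_mul_of_nonneg_left (hΔ x hx _ (hp x)) hBr.le
  have hbs : ∀ x y, b x = b y → s y ≤ s x + Δ / B := by
    intro x y hxy
    have h1 : (b x : ℝ) ≤ s x * B / Δ :=
      Nat.floor_le (div_nonneg (mul_nonneg (hs0 x) hBr.le) hΔ0.le)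
    have h2 : s y * B / Δ < b y + 1 := Nat.lt_floor_add_one _
    rw [← hxy] at h2
    have h3 : s y * B / Δ ≤ s x * B / Δ + 1 := by linarith
    rw [div_add_one hΔ0.ne', div_le_div_iff_of_pos_right hΔ0] at h3
    rw [← sub_nonneg] at h3 ⊢
    have : s x + Δ / B - s y = (s x * B + Δ - s y * B) / B := by field_simp
    rw [this]
    exact div_nonneg h3 hBr.le
  have hrep : ∀ c : ℕ × ℕ, ∃ x, (∃ y ∈ B1 d, (f y, b y) = c) → x ∈ B1 d ∧ (f x, b x) = c := by
    intro c
    by_cases hc : ∃ y ∈ B1 d, (f y, b y) = c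
    · obtain ⟨y, hy⟩ := hc
      exact ⟨y, fun _ => hy⟩
    · exact ⟨0, fun h => absurd h hc⟩
  choose rep hrep using hrep
  set E : ℕ → Set ℝ := fun c => {w | ∃ y ∈ B1 d, ∃ z ∈ B1 d, f y = c ∧ f z = c ∧ w = N (y - z)}
    with hE
  have hEb : ∀ c, BddAbove (E c) := by
    intro c
    refine ⟨Δ, ?_⟩
    rintro w ⟨y, hy, z, hz, _, _, rfl⟩
    exact hΔ y hy z hz
  set ρ : ℕ × ℕ → ℝ := fun c => sSup (E c.1) + 2 * s (rep c) + Δ / B with hρ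
  have hq : ∀ x ∈ B1 d, rep (f x, b x) ∈ B1 d ∧ f (rep (f x, b x)) = f x ∧
      b (rep (f x, b x)) = b x := by
    intro x hx
    have := hrep (f x, b x) ⟨x, hx, rfl⟩
    simpa using this
  have hv : ∀ x, ∃ v, x ∈ B1 d → v ∈ S ∧ 0 ≤ ρ (f x, b x) ∧
      N (p x - p (rep (f x, b x)) - (2 * t * ρ (f x, b x)) • v) ≤ 2 * t * ρ (f x, b x) * ε := by
    intro x
    by_cases hx : x ∈ B1 d
    swap
    · exact ⟨0, fun h => absurd h hx⟩
    obtain ⟨h1, h2, h3⟩ := hq x hx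
    set x' := rep (f x, b x) with hx'
    have hD : N (x - x') ≤ sSup (E (f x)) := le_csSup (hEb _) ⟨x, hx, x', h1, rfl, h2, rfl⟩
    have hsx := hbs x' x h3
    have hpp : N (p x - p x') ≤ ρ (f x, b x) := by
      have a1 := h.tri (p x) x (p x')
      have a2 := h.tri x x' (p x')
      rw [h.sub_comm (p x) x] at a1
      simp only [hρ]
      simp only [hs] at hsx ⊢
      linarith
    have hρ0 : 0 ≤ ρ (f x, b x) := (h.nonneg _).trans hpp
    have hk := h.key ht (hp x) (hm x) (hm x')
    have hk2 := hk.trans (mul_le_mul_of_nonneg_left hpp (by positivity))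
    obtain ⟨v, hv, hv'⟩ := h.net_scale S hS (by positivity) _ hk2
    exact ⟨v, fun _ => ⟨hv, hρ0, hv'⟩⟩
  choose v hv using hv
  obtain ⟨e, he, hei⟩ := exists_index S
  have hem : ∀ x ∈ B1 d, e (v x) < m := fun x hx => (he _ (hv x hx).1).trans_le hSm
  have hbm : ∀ x ∈ B1 d, b x * m + e (v x) < (B + 1) * m := fun x hx =>
    encode_lt (hem x hx) (hbB x hx)
  have hdec : ∀ x ∈ B1 d, ∀ y ∈ B1 d,
      f x * ((B + 1) * m) + (b x * m + e (v x)) = f y * ((B + 1) * m) + (b y * m + e (v y)) →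
      f x = f y ∧ b x = b y ∧ v x = v y := by
    intro x hx y hy hxy
    obtain ⟨h1, h2⟩ := decode (hbm x hx) (hbm y hy) hxy
    obtain ⟨h3, h4⟩ := decode (hem x hx) (hem y hy) h2
    exact ⟨h1, h3, hei _ (hv x hx).1 _ (hv y hy).1 h4⟩
  refine ⟨fun x => f x * ((B + 1) * m) + (b x * m + e (v x)), ?_, ?_, ?_⟩
  · intro x hx
    exact encode_lt (hbm x hx) (hf x hx)
  · intro x hx y hy hxy
    exact (hdec x hx y hy hxy).1
  · intro x hx δ hδ y hy z hz hyx hzx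
    obtain ⟨y1, y2, y3⟩ := hdec y hy x hx hyx
    obtain ⟨z1, z2, z3⟩ := hdec z hz x hx hzx
    obtain ⟨h1, h2, h3⟩ := hq x hx
    have hy4 := (hv y hy).2.2
    have hz4 := (hv z hz).2.2
    rw [y1, y2, y3] at hy4
    rw [z1, z2, z3] at hz4
    set x' := rep (f x, b x) with hx'
    have hD : sSup (E (f x)) ≤ δ := by
      have hne : (E (f x)).Nonempty := ⟨N (x - x), x, hx, x, hx, rfl, rfl, rfl⟩
      apply csSup_le hne
      rintro w ⟨y, hy, z, hz, e1, e2, rfl⟩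
      exact hδ y hy z hz e1 e2
    have s1 := hbs x x' h3.symm
    have s2 := hbs x y y2.symm
    have s3 := hbs x z z2.symm
    set R := 2 * t * ρ (f x, b x) with hR
    have hpyz : N (p y - p z) ≤ 2 * (R * ε) := by
      have a := h.add_le (p y - p x' - R • v x) (-(p z - p x' - R • v x))
      rw [h.neg] at a
      have : p y - p x' - R • v x + -(p z - p x' - R • v x) = p y - p z := by abel
      rw [this] at a
      linarith
    have hRθ : 2 * (R * ε) = θ * ρ (f x, b x) := by rw [hR, ← hθ]; ring
    have t1 := h.tri y (p y) z
    have t2 := h.tri (p y) (p z) z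
    rw [h.sub_comm (p z) z] at t2
    have hρ1 : ρ (f x, b x) ≤ δ + 2 * (s x + Δ / B) + Δ / B := by
      simp only [hρ]
      linarith
    have hρ2 := mul_le_mul_of_nonneg_left hρ1 hθ0
    have hΔB : 0 ≤ Δ / B := by positivity
    have q1 : θ * s x ≤ 1 * s x := mul_le_mul_of_nonneg_right hθ1 (hs0 x)
    have q2 : θ * (Δ / B) ≤ 1 * (Δ / B) := mul_le_mul_of_nonneg_right hθ1 hΔB
    have e1 : N (y - z) ≤ s y + s z + θ * ρ (f x, b x) := by
      simp only [hs]
      linarith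
    have e2 : θ * (δ + 2 * (s x + Δ / B) + Δ / B) = θ * δ + 2 * (θ * s x) + 3 * (θ * (Δ / B)) := by
      ring
    show N (y - z) ≤ θ * δ + 4 * s x + 5 * (Δ / B)
    linarith

end UNorm

lemma summable_double (r : ℝ) (hr : 1 < r) : Summable fun n : ℕ => r ^ n / (2 : ℝ) ^ 2 ^ n := by
  have hr0 : 0 < r := by linarith
  refine summable_of_ratio_test_tendsto_lt_one (l := 0) one_pos
    (Filter.Eventually.of_forall fun n => by positivity) ?_
  have e : (fun n : ℕ => ‖r ^ (n + 1) / (2 : ℝ) ^ 2 ^ (n + 1)‖ / ‖r ^ n / (2 : ℝ) ^ 2 ^ n‖) =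
      fun n : ℕ => r * ((1 / 2 : ℝ) ^ 2 ^ n) := by
    funext n
    rw [Real.norm_of_nonneg (by positivity), Real.norm_of_nonneg (by positivity)]
    rw [pow_succ 2 n, pow_mul, pow_succ r n, one_div, inv_pow]
    field_simp
  rw [e]
  have h1 : Filter.Tendsto (fun n : ℕ => (1 / 2 : ℝ) ^ 2 ^ n) Filter.atTop (nhds 0) :=
    (tendsto_pow_atTop_nhds_zero_of_lt_one (by norm_num) (by norm_num)).comp
      (tendsto_pow_atTop_atTop_of_one_lt one_lt_two)
  simpa using h1.const_mul r

/-- The constant in the chaining bound. -/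
def cst (r : ℝ) : ℝ :=
  2 * (2 + 32 * r ^ 3 / (r - 1) + 10 * r * ∑' n : ℕ, r ^ n / (2 : ℝ) ^ 2 ^ n)

lemma cst_pos (r : ℝ) (hr : 1 < r) : 0 < cst r := by
  have : 0 < r - 1 := by linarith
  have hr0 : 0 < r := by linarith
  have h1 : 0 ≤ ∑' n : ℕ, r ^ n / (2 : ℝ) ^ 2 ^ n := tsum_nonneg fun n => by positivity
  unfold cst
  positivity

namespace UNorm

variable {d : ℕ} {N : (Fin d → ℝ) → ℝ}

lemma chain (h : UNorm d N) {r κ : ℝ} (hr : 1 < r) (hκ : 0 < κ)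
    (hnet : ∀ n : ℕ, ∃ S : Finset (Fin d → ℝ), S.card < 2 ^ 2 ^ n ∧
      ∀ u ∈ B1 d, ∃ v ∈ S, N (u - v) ≤ κ / r ^ n) :
    ∃ f : ℕ → (Fin d → ℝ) → ℕ, (∀ x, f 0 x = 0) ∧
      (∀ n, ∀ x ∈ B1 d, f n x < 2 ^ (3 * 2 ^ n)) ∧
      (∀ n, ∀ x ∈ B1 d, ∀ y ∈ B1 d, f (n + 1) x = f (n + 1) y → f n x = f n y) ∧
      ∀ x ∈ B1 d, ∃ δ : ℕ → ℝ, (∀ n, 0 ≤ δ n) ∧ δ 0 = 2 * κ ∧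
        (∀ n, ∀ y ∈ B1 d, ∀ z ∈ B1 d, f n y = f n x → f n z = f n x → N (y - z) ≤ δ n) ∧
        ∀ M, ∑ n ∈ Finset.range M, r ^ n * δ n ≤ cst r * κ := by
  have hr0 : 0 < r := by linarith
  have hr1 : 0 < r - 1 := by linarith
  -- diameter bound
  have hΔ : ∀ x ∈ B1 d, ∀ y ∈ B1 d, N (x - y) ≤ 2 * κ := by
    obtain ⟨S, hS, hS'⟩ := hnet 0
    intro x hx y hy
    obtain ⟨v, hv, hv'⟩ := hS' x hx
    obtain ⟨w, hw, hw'⟩ := hS' y hy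
    have hc : S.card ≤ 1 := by simpa using Nat.le_of_lt_succ (by simpa using hS)
    have : v = w := Finset.card_le_one.1 hc v hv w hw
    subst this
    have := h.tri x v y
    rw [h.sub_comm v y] at this
    simp at hv' hw'
    linarith
  choose S hScard hS using hnet
  set a : ℝ := 1 / (8 * r * κ) with ha
  have ha0 : 0 < a := by positivity
  choose p hp hm using fun (n : ℕ) (x : Fin d → ℝ) => h.exists_min (a * r ^ n) x
  set θ : ℝ := 1 / (2 * r) with hθ
  have hstep : ∀ (n : ℕ) (F : (Fin d → ℝ) → ℕ), ∃ g : (Fin d → ℝ) → ℕ,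
      (∀ x ∈ B1 d, F x < 2 ^ (3 * 2 ^ n)) →
      (∀ x ∈ B1 d, g x < 2 ^ (3 * 2 ^ (n + 1))) ∧
      (∀ x ∈ B1 d, ∀ y ∈ B1 d, g x = g y → F x = F y) ∧
      ∀ x ∈ B1 d, ∀ δ : ℝ,
        (∀ y ∈ B1 d, ∀ z ∈ B1 d, F y = F x → F z = F x → N (y - z) ≤ δ) →
        ∀ y ∈ B1 d, ∀ z ∈ B1 d, g y = g x → g z = g x →
          N (y - z) ≤ θ * δ + 4 * N (x - p n x) + 5 * (2 * κ / (2 : ℝ) ^ 2 ^ n) := by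
    intro n F
    by_cases hF : ∀ x ∈ B1 d, F x < 2 ^ (3 * 2 ^ n)
    swap
    · exact ⟨F, fun h => absurd h hF⟩
    obtain ⟨g, g1, g2, g3⟩ := h.refine_step (t := a * r ^ n) (ε := κ / r ^ n) (θ := θ) (Δ := 2 * κ)
      (by positivity) (S n) (hS n)
      (by rw [ha, hθ]; field_simp; norm_num) (by positivity)
      (by rw [hθ, div_le_one (by positivity)]; linarith) (p n) (hp n) (hm n) (by positivity) hΔ
      (B := 2 ^ 2 ^ n) (m := 2 ^ 2 ^ n) (by positivity) (hScard n).le F hF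
    refine ⟨g, fun _ => ⟨fun x hx => (g1 x hx).trans_le ?_, g2, ?_⟩⟩
    · have h1 : 2 ^ 2 ^ n + 1 ≤ 2 ^ (2 ^ n + 1) := by
        have : 1 ≤ 2 ^ 2 ^ n := Nat.one_le_two_pow
        rw [pow_succ]; omega
      have h2 : 1 ≤ 2 ^ n := Nat.one_le_two_pow
      calc 2 ^ (3 * 2 ^ n) * ((2 ^ 2 ^ n + 1) * 2 ^ 2 ^ n)
          ≤ 2 ^ (3 * 2 ^ n) * (2 ^ (2 ^ n + 1) * 2 ^ 2 ^ n) := by gcongr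
        _ = 2 ^ (3 * 2 ^ n + (2 ^ n + 1 + 2 ^ n)) := by rw [← pow_add, ← pow_add]
        _ ≤ 2 ^ (3 * 2 ^ (n + 1)) := by
          apply Nat.pow_le_pow_right (by norm_num)
          rw [pow_succ]; omega
    · intro x hx δ hδ y hy z hz e1 e2
      have := g3 x hx δ hδ y hy z hz e1 e2
      simpa using this
  choose G hG using hstep
  set f : ℕ → (Fin d → ℝ) → ℕ := fun n => Nat.rec (fun _ => 0) (fun n F => G n F) n with hf
  have f0 : ∀ x, f 0 x = 0 := fun x => rfl
  have fs : ∀ n, f (n + 1) = G n (f n) := fun n => rfl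
  have hfb : ∀ n, ∀ x ∈ B1 d, f n x < 2 ^ (3 * 2 ^ n) := by
    intro n
    induction n with
    | zero => intro x hx; rw [f0]; positivity
    | succ n ih => rw [fs]; exact (hG n (f n) ih).1
  refine ⟨f, f0, hfb, fun n => by rw [fs]; exact (hG n (f n) (hfb n)).2.1, ?_⟩
  intro x hx
  set δ : ℕ → ℝ := fun n => Nat.rec (2 * κ)
    (fun n D => θ * D + 4 * N (x - p n x) + 5 * (2 * κ / (2 : ℝ) ^ 2 ^ n)) n with hδ
  have d0 : δ 0 = 2 * κ := rfl
  have ds : ∀ n, δ (n + 1) = θ * δ n + 4 * N (x - p n x) + 5 * (2 * κ / (2 : ℝ) ^ 2 ^ n) :=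
    fun n => rfl
  have hθ0 : 0 < θ := by positivity
  refine ⟨δ, ?_, d0, ?_, ?_⟩
  · intro n
    induction n with
    | zero => rw [d0]; positivity
    | succ n ih =>
      rw [ds]
      have := h.nonneg (x - p n x)
      positivity
  · intro n
    induction n with
    | zero => intro y hy z hz _ _; rw [d0]; exact hΔ y hy z hz
    | succ n ih =>
      rw [ds, fs]
      exact (hG n (f n) (hfb n)).2.2 x hx (δ n) ih
  · have hint := fun M => h.interp ha0 hr hx (fun n => p n x) (fun n => hp n x) (fun n => hm n x) M
    have hsum : ∀ M, ∑ n ∈ Finset.range M, r ^ n / (2 : ℝ) ^ 2 ^ n ≤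
        ∑' n : ℕ, r ^ n / (2 : ℝ) ^ 2 ^ n := fun M =>
      (summable_double r hr).sum_le_tsum _ fun n _ => by positivity
    intro M
    induction M with
    | zero =>
      have := cst_pos r hr
      simp only [Finset.range_zero, Finset.sum_empty]
      positivity
    | succ M ih =>
      rw [Finset.sum_range_succ', pow_zero, one_mul, d0]
      have e : ∑ k ∈ Finset.range M, r ^ (k + 1) * δ (k + 1) =
          (r * θ) * ∑ n ∈ Finset.range M, r ^ n * δ n +
          4 * r * ∑ n ∈ Finset.range M, r ^ n * N (x - p n x) +
          10 * r * κ * ∑ n ∈ Finset.range M, r ^ n / (2 : ℝ) ^ 2 ^ n := by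
        simp only [Finset.mul_sum, ← Finset.sum_add_distrib]
        refine Finset.sum_congr rfl fun n _ => ?_
        rw [ds]
        ring
      have hrθ : r * θ = 1 / 2 := by rw [hθ]; field_simp
      rw [e, hrθ]
      have i1 := mul_le_mul_of_nonneg_left (hint M) (show 0 ≤ 4 * r by positivity)
      have i2 := mul_le_mul_of_nonneg_left (hsum M) (show 0 ≤ 10 * r * κ by positivity)
      have i3 : 4 * r * (r / (a * (r - 1))) = 32 * r ^ 3 / (r - 1) * κ := by
        rw [ha]; field_simp; norm_num
      rw [i3] at i1
      have i4 : cst r * κ = 2 * (2 * κ + 32 * r ^ 3 / (r - 1) * κ +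
        10 * r * κ * ∑' n : ℕ, r ^ n / (2 : ℝ) ^ 2 ^ n) := by
        unfold cst; ring
      linarith

end UNorm

lemma lower_bound {X : Type u} (D : X → X → ℝ≥0∞) (α : ℝ) (T : Set X) :
    (⨆ n : ℕ, (2 : ℝ≥0∞) ^ ((n : ℝ) / α) * entN D n T) ≤ gammaF D α 1 T := by
  classical
  refine iSup_le fun n => le_iInf fun P => ?_
  simp only [ENNReal.rpow_one, inv_one]
  have h1 : entN D n T ≤ ⨆ x ∈ T, eDiam D (P.piece n x) := by
    have hrep : ∀ A : Set X, (∃ x ∈ T, P.piece n x = A) → ∃ y, y ∈ A := by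
      rintro A ⟨x, hx, rfl⟩
      exact ⟨x, P.self_mem n x hx⟩
    by_cases hX : Nonempty X
    swap
    · rw [not_nonempty_iff] at hX
      refine (iInf₂_le ∅ (by simp)).trans ?_
      exact iSup₂_le fun x => (hX.false x).elim
    have hrep' : ∀ A : Set X, ∃ y, (∃ x ∈ T, P.piece n x = A) → y ∈ A := by
      intro A
      by_cases hA : ∃ x ∈ T, P.piece n x = A
      · obtain ⟨y, hy⟩ := hrep A hA
        exact ⟨y, fun _ => hy⟩
      · exact ⟨hX.some, fun h => absurd h hA⟩
    choose rep hr using hrep'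
    refine (iInf₂_le ((P.finite_pieces n).toFinset.image rep) ?_).trans ?_
    · refine Finset.card_image_le.trans_lt ?_
      rw [← Set.ncard_eq_toFinset_card _ (P.finite_pieces n)]
      exact P.card_pieces n
    · refine iSup₂_mono fun x hx => ?_
      refine (iInf₂_le (rep (P.piece n x)) ?_).trans ?_
      · apply Finset.mem_image_of_mem
        simp only [Set.Finite.mem_toFinset, Set.mem_ofPred_eq]
        exact ⟨x, hx, rfl⟩
      · unfold eDiam
        exact le_iSup₂_of_le x (P.self_mem n x hx)
          (le_iSup₂_of_le (rep (P.piece n x)) (hr _ ⟨x, hx, rfl⟩) le_rfl)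
  refine (mul_le_mul_right h1 _).trans ?_
  simp only [ENNReal.mul_iSup]
  exact iSup₂_mono fun x hx =>
    ENNReal.le_tsum (f := fun n : ℕ => (2 : ℝ≥0∞) ^ ((n : ℝ) / α) * eDiam D (P.piece n x)) n

/-- Admissible sequence from a refining sequence of labellings. -/
def admOfLabels {X : Type u} (T : Set X) (f : ℕ → X → ℕ) (f0 : ∀ x, f 0 x = 0)
    (hb : ∀ n, ∀ x ∈ T, f n x < 2 ^ (3 * 2 ^ n))
    (hn : ∀ n, ∀ x ∈ T, ∀ y ∈ T, f (n + 1) x = f (n + 1) y → f n x = f n y) : Admissible T :=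
  have key : ∀ n, ∃ M : ℕ, M < 2 ^ 2 ^ n ∧ {A : Set X | ∃ x ∈ T,
      {y | y ∈ T ∧ f (n - 2) y = f (n - 2) x} = A} ⊆
      Set.image (fun k => {y | y ∈ T ∧ f (n - 2) y = k}) (Finset.range M : Set ℕ) := by
    intro n
    obtain ⟨M, h1, h2⟩ : ∃ M : ℕ, M < 2 ^ 2 ^ n ∧ ∀ x ∈ T, f (n - 2) x < M := by
      rcases n with _ | _ | n
      · exact ⟨1, by norm_num, fun x _ => by rw [f0]; norm_num⟩
      · exact ⟨1, by norm_num, fun x _ => by rw [f0]; norm_num⟩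
      · refine ⟨2 ^ (3 * 2 ^ n), ?_, hb n⟩
        apply Nat.pow_lt_pow_right (by norm_num)
        have : 0 < 2 ^ n := by positivity
        rw [pow_succ, pow_succ]
        omega
    refine ⟨M, h1, ?_⟩
    rintro A ⟨x, hx, rfl⟩
    exact ⟨f (n - 2) x, by simpa using h2 x hx, rfl⟩
  { piece := fun n x => {y | y ∈ T ∧ f (n - 2) y = f (n - 2) x}
    self_mem := fun n x hx => ⟨hx, rfl⟩
    subset_base := fun n x _ y hy => hy.1
    partition := by
      intro n x _ y _ hy
      have : f (n - 2) y = f (n - 2) x := hy.2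
      simp only [this]
    finite_pieces := by
      intro n
      obtain ⟨M, _, h2⟩ := key n
      exact ((Finset.finite_toSet _).image _).subset h2
    card_pieces := by
      intro n
      obtain ⟨M, h1, h2⟩ := key n
      refine lt_of_le_of_lt ?_ h1
      refine (Set.ncard_le_ncard h2 ((Finset.finite_toSet _).image _)).trans ?_
      refine (Set.ncard_image_le (Finset.finite_toSet _)).trans ?_
      rw [Set.ncard_coe_finset, Finset.card_range]
    nested := by
      intro n x hx y hy
      refine ⟨hy.1, ?_⟩
      have h2 := hy.2
      rcases n with _ | _ | n
      · simp [f0]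
      · simp [f0]
      · exact hn n y hy.1 x hx h2 }

lemma upper_bound (α : ℝ) (hα : 0 < α) {d : ℕ} {N : (Fin d → ℝ) → ℝ} (h : UNorm d N) {κ : ℝ}
    (hκ : 0 < κ)
    (hK : (⨆ n : ℕ, (2 : ℝ≥0∞) ^ ((n : ℝ) / α) *
      entN (fun x y => ENNReal.ofReal (N (x - y))) n (B1 d)) < ENNReal.ofReal κ) :
    gammaF (fun x y => ENNReal.ofReal (N (x - y))) α 1 (B1 d) ≤
      ENNReal.ofReal ((2 + 2 * (2 : ℝ) ^ (1 / α) +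
        ((2 : ℝ) ^ (1 / α)) ^ 2 * cst ((2 : ℝ) ^ (1 / α))) * κ) := by
  set r : ℝ := (2 : ℝ) ^ (1 / α) with hr
  have hr1 : 1 < r := Real.one_lt_rpow one_lt_two (by positivity)
  have hr0 : 0 < r := by linarith
  have hrn : ∀ n : ℕ, (2 : ℝ≥0∞) ^ ((n : ℝ) / α) = ENNReal.ofReal (r ^ n) := by
    intro n
    rw [hr, ← Real.rpow_natCast, ← Real.rpow_mul (by norm_num),
      ← ENNReal.ofReal_rpow_of_pos (by norm_num)]
    congr 1
    · simp
    · ring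
  have hnet : ∀ n : ℕ, ∃ S : Finset (Fin d → ℝ), S.card < 2 ^ 2 ^ n ∧
      ∀ u ∈ B1 d, ∃ v ∈ S, N (u - v) ≤ κ / r ^ n := by
    intro n
    have h1 := (le_iSup (fun n : ℕ => (2 : ℝ≥0∞) ^ ((n : ℝ) / α) *
      entN (fun x y => ENNReal.ofReal (N (x - y))) n (B1 d)) n).trans_lt hK
    simp only [hrn] at h1
    have h2 : entN (fun x y => ENNReal.ofReal (N (x - y))) n (B1 d) <
        ENNReal.ofReal (κ / r ^ n) := by
      rw [ENNReal.ofReal_div_of_pos (by positivity)]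
      rw [ENNReal.lt_div_iff_mul_lt (Or.inl (ENNReal.ofReal_pos.2 (by positivity)).ne')
        (Or.inl ENNReal.ofReal_ne_top), mul_comm]
      exact h1
    unfold entN at h2
    simp only [iInf_lt_iff] at h2
    obtain ⟨S, hS, h3⟩ := h2
    refine ⟨S, hS, fun u hu => ?_⟩
    have h4 := (le_iSup₂ (f := fun (x : Fin d → ℝ) (_ : x ∈ B1 d) =>
      ⨅ y ∈ S, ENNReal.ofReal (N (x - y))) u hu).trans_lt h3
    simp only [iInf_lt_iff] at h4
    obtain ⟨v, hv, h5⟩ := h4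
    exact ⟨v, hv, ((ENNReal.ofReal_lt_ofReal_iff (by positivity)).1 h5).le⟩
  obtain ⟨f, f0, fb, fn, fd⟩ := h.chain hr1 hκ hnet
  refine (iInf_le _ (admOfLabels (B1 d) f f0 fb fn)).trans ?_
  simp only [ENNReal.rpow_one, inv_one]
  refine iSup₂_le fun x hx => ?_
  obtain ⟨δ, hδ0, hδ, hδd, hδs⟩ := fd x hx
  refine ENNReal.tsum_le_of_sum_range_le fun M => ?_
  have hterm : ∀ k : ℕ, (2 : ℝ≥0∞) ^ ((k : ℝ) / α) *
      eDiam (fun x y => ENNReal.ofReal (N (x - y)))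
        ((admOfLabels (B1 d) f f0 fb fn).piece k x) ≤ ENNReal.ofReal (r ^ k * δ (k - 2)) := by
    intro k
    rw [hrn, ENNReal.ofReal_mul (by positivity)]
    refine mul_le_mul_right ?_ _
    refine iSup₂_le fun y hy => iSup₂_le fun z hz => ?_
    exact ENNReal.ofReal_le_ofReal (hδd _ y hy.1 z hz.1 hy.2 hz.2)
  refine (Finset.sum_le_sum fun k _ => hterm k).trans ?_
  rw [← ENNReal.ofReal_sum_of_nonneg fun k _ => mul_nonneg (by positivity) (hδ0 _)]
  apply ENNReal.ofReal_le_ofReal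
  have h1 : ∑ k ∈ Finset.range M, r ^ k * δ (k - 2) ≤
      ∑ k ∈ Finset.range (M + 2), r ^ k * δ (k - 2) :=
    Finset.sum_le_sum_of_subset_of_nonneg (Finset.range_mono (by omega))
      fun k _ _ => mul_nonneg (by positivity) (hδ0 _)
  refine h1.trans ?_
  rw [Finset.sum_range_succ', Finset.sum_range_succ']
  have h2 : ∑ k ∈ Finset.range M, r ^ (k + 1 + 1) * δ (k + 1 + 1 - 2) =
      r ^ 2 * ∑ k ∈ Finset.range M, r ^ k * δ k := by
    rw [Finset.mul_sum]
    refine Finset.sum_congr rfl fun k _ => ?_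
    have : k + 1 + 1 - 2 = k := by omega
    rw [this]
    ring
  rw [h2]
  have h3 := mul_le_mul_of_nonneg_left (hδs M) (show 0 ≤ r ^ 2 by positivity)
  simp only [zero_add, Nat.reduceSub, hδ, pow_zero, pow_one]
  linarith

/-- **Sharpness of the Sudakov bound for the ℓ¹-ball.** For any `1`-unconditional
norm `N` on `ℝ^d`, with distance `d(x,y) = N(x−y)`, one has
`γ_α(B₁^d) ≍ sup_n 2^{n/α} e_n(B₁^d)` with constants depending only on `α`. -/
theorem sudakov_sharp_l1_ball (α : ℝ) (hα : 0 < α) :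
    ∃ c C : ℝ≥0∞, 0 < c ∧ c ≠ ∞ ∧ 0 < C ∧ C ≠ ∞ ∧
      ∀ (d : ℕ) (N : (Fin d → ℝ) → ℝ),
        (∀ x, 0 ≤ N x) →
        (∀ x, N x = 0 ↔ x = 0) →
        (∀ (t : ℝ) (x), N (t • x) = |t| * N x) →
        (∀ x y, N (x + y) ≤ N x + N y) →
        (∀ (ε : Fin d → ℝ) (x), (∀ i, ε i = 1 ∨ ε i = -1) →
          N (fun i => ε i * x i) = N x) →
        c * (⨆ n : ℕ, (2 : ℝ≥0∞) ^ ((n : ℝ) / α) *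
              entN (fun x y => ENNReal.ofReal (N (x - y))) n
                {x : Fin d → ℝ | ∑ i, |x i| ≤ 1}) ≤
            gammaF (fun x y => ENNReal.ofReal (N (x - y))) α 1
              {x : Fin d → ℝ | ∑ i, |x i| ≤ 1} ∧
          gammaF (fun x y => ENNReal.ofReal (N (x - y))) α 1
              {x : Fin d → ℝ | ∑ i, |x i| ≤ 1} ≤
            C * ⨆ n : ℕ, (2 : ℝ≥0∞) ^ ((n : ℝ) / α) *
              entN (fun x y => ENNReal.ofReal (N (x - y))) n
                {x : Fin d → ℝ | ∑ i, |x i| ≤ 1} := by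
  set C0 : ℝ := 2 + 2 * (2 : ℝ) ^ (1 / α) +
        ((2 : ℝ) ^ (1 / α)) ^ 2 * cst ((2 : ℝ) ^ (1 / α)) with hC0
  have hC : 0 < C0 := by
    have := cst_pos ((2 : ℝ) ^ (1 / α)) (Real.one_lt_rpow one_lt_two (by positivity))
    positivity
  refine ⟨1, ENNReal.ofReal C0, one_pos, ENNReal.one_ne_top, ENNReal.ofReal_pos.2 hC,
    ENNReal.ofReal_ne_top, ?_⟩
  intro d N h1 h2 h3 h4 h5
  have h : UNorm d N := ⟨h1, h2, h3, h4, h5⟩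
  refine ⟨?_, ?_⟩
  · rw [one_mul]
    exact lower_bound _ _ _
  · change gammaF (fun x y => ENNReal.ofReal (N (x - y))) α 1 (B1 d) ≤
      ENNReal.ofReal C0 * ⨆ n : ℕ, (2 : ℝ≥0∞) ^ ((n : ℝ) / α) *
              entN (fun x y => ENNReal.ofReal (N (x - y))) n (B1 d)
    rw [mul_comm, ← ENNReal.div_le_iff (ENNReal.ofReal_pos.2 hC).ne' ENNReal.ofReal_ne_top]
    refine le_of_forall_gt_imp_ge_of_dense fun k hk => ?_
    rcases eq_or_ne k ∞ with rfl | hk'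
    · exact le_top
    have hk0 : 0 < k.toReal := ENNReal.toReal_pos (bot_le.trans_lt hk).ne' hk'
    rw [← ENNReal.ofReal_toReal hk'] at hk ⊢
    rw [ENNReal.div_le_iff (ENNReal.ofReal_pos.2 hC).ne' ENNReal.ofReal_ne_top,
      ← ENNReal.ofReal_mul hk0.le, mul_comm]
    exact upper_bound α hα h hk0 hk
end
end

section
/- (Chaining functionals on q-convex bodies.) Let (X,‖·‖) be a Banach space, T ⊂ X a symmetric compact convex set with gauge ‖x‖_T := inf{ s ≥ 0 : x ∈ sT }, and α > 0. Let q ≥ 2 and η > 0, and suppose T is q-convex with constant η, i.e., ‖(x+y)/2‖_T ≤ 1 − η‖x−y‖_T^q for all x,y ∈ T. Then there is a constant C depending only on α such that γ_{α,q}(T) ≤ C · η^{−1/q} · sup_{n≥0} 2^{n/α} e_n(T), where entropy numbers and γ_{α,q} are with respect to the norm metric d(x,y) = ‖x−y‖. -/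
open scoped ENNReal NNReal
open EMetric Set

noncomputable section

universe u

theorem chain_sum (u : ℕ → ℝ) (j : ℕ → ℕ) (φ : ℕ → ℝ) (K L : ℝ) (hu : ∀ n, 0 ≤ u n)
    (hφm : Monotone φ) (hφ0 : ∀ n, 0 ≤ φ n) (hφ1 : ∀ n, φ n ≤ 1) (hK : 0 ≤ K) (hL : 1 < L)
    (h : ∀ n, (j (n + 1) = j n + 1 ∧ u (n + 1) ≤ u n / 4) ∨
      (j (n + 1) = j n ∧ u (n + 1) = L * u n ∧ u n ≤ K * (φ (j n + 2) - φ (j n)))) (N : ℕ) :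
    ∑ n ∈ Finset.range N, u n ≤ (4 / 3) * (u 0 + L * (2 * (L / (L - 1) * K))) := by
  set st : ℕ → ℝ := fun n => if j (n + 1) = j n then u n else 0 with hst
  set c := 1 / (L - 1) with hc
  have hL1 : 0 < L - 1 := by linarith
  have hc0 : 0 < c := by positivity
  have hcL : c * L = c + 1 := by rw [hc]; field_simp; ring
  have hcL' : L / (L - 1) = c + 1 := by rw [hc]; field_simp; ring
  set K' := (c + 1) * K with hK'
  have hK'0 : 0 ≤ K' := by positivity
  have A : ∀ N, ∑ n ∈ Finset.range N, st n ≤ K' * (φ (j N) + φ (j N + 1)) + c * u N ∧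
      ∑ n ∈ Finset.range N, st n ≤
        K' * (φ (j N) + φ (j N + 1)) + K' * (φ (j N + 2) - φ (j N)) := by
    intro N
    induction N with
    | zero =>
      have h1 := hφ0 (j 0)
      have h2 := hφ0 (j 0 + 1)
      have h3 := hφm (show j 0 ≤ j 0 + 2 by omega)
      have h4 := hu 0
      simp only [Finset.range_zero, Finset.sum_empty]
      constructor
      · positivity
      · have : 0 ≤ φ (j 0 + 2) - φ (j 0) := by linarith
        positivity
    | succ N ih =>
      obtain ⟨i1, i2⟩ := ih
      rw [Finset.sum_range_succ]
      rcases h N with ⟨hj, hun⟩ | ⟨hj, hun, hb⟩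
      · have hs : st N = 0 := by simp [hst, hj]
        rw [hs, hj]
        have e : j N + 1 + 1 = j N + 2 := by ring
        have e' : j N + 1 + 2 = j N + 3 := by ring
        rw [e, e']
        have h4 := hu (N + 1)
        have h3 := hφm (show j N + 1 ≤ j N + 3 by omega)
        have h5 : 0 ≤ K' * (φ (j N + 3) - φ (j N + 1)) :=
          mul_nonneg hK'0 (by linarith)
        have h6 : 0 ≤ c * u (N + 1) := by positivity
        constructor <;> nlinarith
      · have hs : st N = u N := by simp [hst, hj]
        rw [hs, hj, hun]
        constructor
        · have : c * (L * u N) = c * u N + u N := by rw [← mul_assoc, hcL]; ring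
          linarith
        · have : (c + 1) * u N ≤ (c + 1) * (K * (φ (j N + 2) - φ (j N))) :=
            mul_le_mul_of_nonneg_left hb (by positivity)
          rw [hK'] at *
          nlinarith
  have A' : ∀ N, ∑ n ∈ Finset.range N, st n ≤ 2 * K' := by
    intro N
    refine (A N).2.trans ?_
    have h1 := hφ1 (j N + 1)
    have h2 := hφ1 (j N + 2)
    nlinarith
  have B : ∀ N, ∑ n ∈ Finset.range (N + 1), u n ≤
      u 0 + (1 / 4) * ∑ n ∈ Finset.range N, u n + L * ∑ n ∈ Finset.range N, st n := by
    intro N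
    induction N with
    | zero => simp
    | succ N ih =>
      rw [Finset.sum_range_succ, Finset.sum_range_succ u N, Finset.sum_range_succ st N]
      rw [Finset.sum_range_succ u N] at ih
      have h4 := hu N
      rcases h N with ⟨hj, hun⟩ | ⟨hj, hun, hb⟩
      · have hs : st N = 0 := by simp [hst, hj]
        rw [hs]; linarith
      · have hs : st N = u N := by simp [hst, hj]
        rw [hs, hun]; linarith
  have h1 := B N
  have h2 := A' N
  rw [Finset.sum_range_succ] at h1
  have h3 := hu N
  rw [hcL']
  have h4 : L * ∑ n ∈ Finset.range N, st n ≤ L * (2 * K') :=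
    mul_le_mul_of_nonneg_left h2 (by linarith)
  linarith

theorem build_admissible {X : Type u} (T : Set X) (good : ℕ → X → X → Prop)
    (bad : ℕ → ℕ → X → Prop) (h0 : ∀ x ∈ T, ∀ y ∈ T, good 0 x y)
    (hs : ∀ (n j : ℕ) (A : Set X), A ⊆ T → (∀ x ∈ A, ∀ y ∈ A, good j x y) →
      ∃ i : X → ℕ, (∀ x ∈ A, i x < 2 ^ 2 ^ n) ∧ (∀ x ∈ A, i x = 0 → bad n j x) ∧
        ∀ x ∈ A, ∀ y ∈ A, i x ≠ 0 → i x = i y → good (j + 1) x y) :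
    ∃ (P : Admissible T) (j : ℕ → X → ℕ), (∀ x ∈ T, j 0 x = 0) ∧
      (∀ n, ∀ x ∈ T, ∀ y ∈ P.piece n x, ∀ z ∈ P.piece n x, good (j n x) y z) ∧
      ∀ n, ∀ x ∈ T, j (n + 1) x = j n x + 1 ∨ (j (n + 1) x = j n x ∧ bad n (j n x) x) := by
  have hs' : ∀ (n j : ℕ) (A : Set X), ∃ i : X → ℕ,
      A ⊆ T → (∀ x ∈ A, ∀ y ∈ A, good j x y) →
      (∀ x ∈ A, i x < 2 ^ 2 ^ n) ∧ (∀ x ∈ A, i x = 0 → bad n j x) ∧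
        ∀ x ∈ A, ∀ y ∈ A, i x ≠ 0 → i x = i y → good (j + 1) x y := by
    intro n j A
    by_cases hA : A ⊆ T ∧ (∀ x ∈ A, ∀ y ∈ A, good j x y)
    · obtain ⟨i, hi⟩ := hs n j A hA.1 hA.2
      exact ⟨i, fun _ _ => hi⟩
    · exact ⟨fun _ => 0, fun h1 h2 => absurd ⟨h1, h2⟩ hA⟩
  choose i hi using hs'
  let st : ℕ → (X → ℕ) × (X → ℕ) := fun n => Nat.rec (fun _ => 0, fun _ => 0)
    (fun n s => (fun x => s.1 x * 2 ^ 2 ^ n + i n (s.2 x) {y | y ∈ T ∧ s.1 y = s.1 x} x,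
      fun x => if i n (s.2 x) {y | y ∈ T ∧ s.1 y = s.1 x} x = 0 then s.2 x else s.2 x + 1)) n
  set k : ℕ → X → ℕ := fun n => (st n).1 with hk
  set j : ℕ → X → ℕ := fun n => (st n).2 with hj
  set pc : ℕ → X → Set X := fun n x => {y | y ∈ T ∧ k n y = k n x} with hpc
  have hk0 : ∀ x, k 0 x = 0 := fun x => rfl
  have hj0 : ∀ x, j 0 x = 0 := fun x => rfl
  have hkS : ∀ n x, k (n + 1) x = k n x * 2 ^ 2 ^ n + i n (j n x) (pc n x) x := fun n x => rfl
  have hjS : ∀ n x, j (n + 1) x = if i n (j n x) (pc n x) x = 0 then j n x else j n x + 1 :=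
    fun n x => rfl
  clear_value k j
  have main : ∀ n, (∀ x ∈ T, k n x + 1 < 2 ^ 2 ^ n) ∧
      (∀ x ∈ T, ∀ y ∈ T, k n x = k n y → j n x = j n y) ∧
      (∀ x ∈ T, ∀ y ∈ T, k n x = k n y → good (j n x) x y) := by
    intro n
    induction n with
    | zero =>
      refine ⟨fun x _ => ?_, fun x _ y _ _ => ?_, fun x hx y hy _ => ?_⟩
      · rw [hk0]; norm_num
      · rw [hj0, hj0]
      · rw [hj0]; exact h0 x hx y hy
    | succ n ih =>
      obtain ⟨a1, a2, a3⟩ := ih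
      have key : ∀ x ∈ T, _ := fun x (hx : x ∈ T) => hi n (j n x) (pc n x) (fun y hy => hy.1)
        (fun y hy z hz => by
          have := a3 y hy.1 z hz.1 (hy.2.trans hz.2.symm)
          rwa [a2 y hy.1 x hx hy.2] at this)
      have self : ∀ x ∈ T, x ∈ pc n x := fun x hx => ⟨hx, rfl⟩
      have kk : ∀ x ∈ T, ∀ y ∈ T, k (n + 1) x = k (n + 1) y → k n x = k n y ∧
          i n (j n x) (pc n x) x = i n (j n y) (pc n y) y := by
        intro x hx y hy h
        have hx1 := (key x hx).1 x (self x hx)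
        have hy1 := (key y hy).1 y (self y hy)
        rw [hkS, hkS] at h
        generalize i n (j n x) (pc n x) x = a at *
        generalize i n (j n y) (pc n y) y = b at *
        have hB : 0 < 2 ^ 2 ^ n := by positivity
        generalize 2 ^ 2 ^ n = B at *
        have e1 : (k n x * B + a) / B = k n x := by
          rw [mul_comm, Nat.mul_add_div hB, Nat.div_eq_of_lt hx1, add_zero]
        have e2 : (k n y * B + b) / B = k n y := by
          rw [mul_comm, Nat.mul_add_div hB, Nat.div_eq_of_lt hy1, add_zero]
        have e : k n x = k n y := by rw [← e1, ← e2, h]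
        refine ⟨e, ?_⟩
        rw [e] at h
        omega
      have pceq : ∀ x ∈ T, ∀ y ∈ T, k n x = k n y → pc n x = pc n y := by
        intro x _ y _ h
        simp only [hpc, h]
      refine ⟨fun x hx => ?_, fun x hx y hy h => ?_, fun x hx y hy h => ?_⟩
      · have hx1 := (key x hx).1 x (self x hx)
        have hx2 := a1 x hx
        rw [hkS]
        have : (2 : ℕ) ^ 2 ^ (n + 1) = 2 ^ 2 ^ n * 2 ^ 2 ^ n := by
          rw [← pow_add]; congr 1; ring
        rw [this]
        generalize i n (j n x) (pc n x) x = a at *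
        generalize 2 ^ 2 ^ n = B at *
        have : (k n x + 2) * B ≤ B * B := Nat.mul_le_mul_right B (by omega)
        have e : (k n x + 2) * B = k n x * B + 2 * B := by ring
        omega
      · obtain ⟨e1, e2⟩ := kk x hx y hy h
        rw [hjS, hjS, e2, a2 x hx y hy e1]
      · obtain ⟨e1, e2⟩ := kk x hx y hy h
        rw [hjS]
        split_ifs with h0
        · exact a3 x hx y hy e1
        · refine (key x hx).2.2 x (self x hx) y ⟨hy, e1.symm⟩ h0 ?_
          rw [e2, ← a2 x hx y hy e1, ← pceq x hx y hy e1]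
  have sub : ∀ n, {A : Set X | ∃ x ∈ T, pc n x = A} ⊆
      ((Finset.range (2 ^ 2 ^ n - 1)).image (fun m => {y | y ∈ T ∧ k n y = m}) :
        Finset (Set X)) := by
    rintro n A ⟨x, hx, rfl⟩
    rw [Finset.mem_coe, Finset.mem_image]
    refine ⟨k n x, ?_, rfl⟩
    rw [Finset.mem_range]
    have := (main n).1 x hx
    omega
  have step : ∀ n, ∀ x ∈ T, i n (j n x) (pc n x) x < 2 ^ 2 ^ n ∧
      (i n (j n x) (pc n x) x = 0 → bad n (j n x) x) := by
    intro n x hx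
    obtain ⟨a1, a2, a3⟩ := main n
    have := hi n (j n x) (pc n x) (fun y hy => hy.1)
        (fun y hy z hz => by
          have := a3 y hy.1 z hz.1 (hy.2.trans hz.2.symm)
          rwa [a2 y hy.1 x hx hy.2] at this)
    exact ⟨this.1 x ⟨hx, rfl⟩, this.2.1 x ⟨hx, rfl⟩⟩
  refine ⟨⟨pc, fun n x hx => ⟨hx, rfl⟩, fun n x _ y hy => hy.1, ?_, ?_, ?_, ?_⟩, j, ?_, ?_, ?_⟩
  · intro n x _ y _ hxy
    simp only [hpc, hxy.2]
  · intro n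
    exact (Finset.finite_toSet _).subset (sub n)
  · intro n
    refine lt_of_le_of_lt (Set.ncard_le_ncard (sub n) (Finset.finite_toSet _)) ?_
    rw [Set.ncard_coe_finset]
    refine lt_of_le_of_lt Finset.card_image_le ?_
    rw [Finset.card_range]
    have : 0 < 2 ^ 2 ^ n := by positivity
    omega
  · intro n x hx y hy
    refine ⟨hy.1, ?_⟩
    have h := hy.2
    have hx1 := (step n x hx).1
    have hy1 := (step n y hy.1).1
    rw [hkS, hkS] at h
    generalize i n (j n x) (pc n x) x = a at *
    generalize i n (j n y) (pc n y) y = b at *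
    have hB : 0 < 2 ^ 2 ^ n := by positivity
    generalize 2 ^ 2 ^ n = B at *
    have e1 : (k n x * B + a) / B = k n x := by
      rw [mul_comm, Nat.mul_add_div hB, Nat.div_eq_of_lt hx1, add_zero]
    have e2 : (k n y * B + b) / B = k n y := by
      rw [mul_comm, Nat.mul_add_div hB, Nat.div_eq_of_lt hy1, add_zero]
    rw [← e1, ← e2, h]
  · intro x _; exact hj0 x
  · intro n x hx y hy z hz
    obtain ⟨a1, a2, a3⟩ := main n
    have := a3 y hy.1 z hz.1 (hy.2.trans hz.2.symm)
    rwa [a2 y hy.1 x hx hy.2] at this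
  · intro n x hx
    rw [hjS]
    split_ifs with h
    · exact Or.inr ⟨rfl, (step n x hx).2 h⟩
    · exact Or.inl rfl

section body

open scoped Pointwise

variable {X : Type u} [NormedAddCommGroup X] [NormedSpace ℝ X]

theorem smul_set_mono {T : Set X} (hc : Convex ℝ T) (h0 : (0 : X) ∈ T) {a b : ℝ}
    (ha : 0 ≤ a) (hab : a ≤ b) {x : X} (hx : x ∈ a • T) : x ∈ b • T := by
  obtain ⟨t, ht, rfl⟩ := hx
  rcases eq_or_lt_of_le ha with h | h
  · exact ⟨0, h0, by simp [← h]⟩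
  · have hb : 0 < b := lt_of_lt_of_le h hab
    refine ⟨(a / b) • t, ?_, ?_⟩
    · exact hc.smul_mem_of_zero_mem h0 ht ⟨by positivity, by rw [div_le_one hb]; exact hab⟩
    · simp only [smul_smul]
      congr 1
      field_simp

theorem mem_gauge_smul {T : Set X} (hT : IsCompact T) (hc : Convex ℝ T) (h0 : (0 : X) ∈ T)
    {s : ℝ} (hs : 0 < s) {x : X} (hx : x ∈ s • T) : x ∈ gauge T x • T := by
  have hall : ∀ r, gauge T x < r → x ∈ r • T := by
    intro r hr
    rw [gauge_def] at hr
    obtain ⟨r', ⟨hr'0, hr'⟩, hlt⟩ := exists_lt_of_csInf_lt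
      (s := {r ∈ Set.Ioi (0 : ℝ) | x ∈ r • T}) ⟨s, hs, hx⟩ hr
    exact smul_set_mono hc h0 (le_of_lt hr'0) hlt.le hr'
  rcases eq_or_lt_of_le (gauge_nonneg (s := T) x) with h | h
  · obtain ⟨R, hR⟩ := hT.isBounded.exists_norm_le
    have hx0 : ‖x‖ ≤ 0 := by
      refine le_of_forall_pos_le_add fun ε hε => ?_
      have hR0 : 0 ≤ R := (norm_nonneg _).trans (hR 0 h0)
      obtain ⟨t, ht, hxt⟩ := hall (ε / (R + 1)) (by rw [← h]; positivity)
      rw [← hxt, norm_smul, Real.norm_eq_abs, abs_of_nonneg (by positivity)]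
      have := hR t ht
      calc ε / (R + 1) * ‖t‖ ≤ ε / (R + 1) * (R + 1) := by gcongr; linarith
        _ = 0 + ε := by field_simp; ring
    have : x = 0 := by simpa using hx0
    exact ⟨0, h0, by simp [this]⟩
  · have : (gauge T x)⁻¹ • x ∈ T := by
      refine hT.isClosed.mem_of_tendsto (f := fun r : ℝ => r⁻¹ • x)
        (b := nhdsWithin (gauge T x) (Set.Ioi (gauge T x))) ?_ ?_
      · have : ContinuousAt (fun r : ℝ => r⁻¹ • x) (gauge T x) :=
          (continuousAt_inv₀ h.ne').smul continuousAt_const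
        exact this.tendsto.mono_left nhdsWithin_le_nhds
      · filter_upwards [self_mem_nhdsWithin] with r hr
        obtain ⟨t, ht, hxt⟩ := hall r hr
        have hr0 : 0 < r := h.trans hr
        rw [← hxt]
        simpa [smul_smul, hr0.ne'] using ht
    exact ⟨_, this, by simp [smul_smul, h.ne']⟩

theorem q_convex_diff {T : Set X} (hT : IsCompact T) (hc : Convex ℝ T) (hsym : T = -T)
    (h0 : (0 : X) ∈ T) {q η : ℝ} (hq : 2 ≤ q) (hη : 0 < η)
    (hqc : ∀ x ∈ T, ∀ y ∈ T, gauge T ((2⁻¹ : ℝ) • (x + y)) ≤ 1 - η * gauge T (x - y) ^ q)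
    {h h₀ ρ : ℝ} (hh0 : 0 ≤ h) (hh1 : h ≤ 1) (hρ : 0 ≤ ρ) {v w : X} (hv : v ∈ h • T)
    (hw : w ∈ h • T)
    (hm : ∀ k : ℝ, 0 ≤ k → k ≤ 1 → (2⁻¹ : ℝ) • (v + w) ∈ k • T → h₀ ≤ k)
    (hle : h - h₀ ≤ η * ρ ^ q) : v - w ∈ ρ • T := by
  obtain ⟨v', hv', rfl⟩ := hv
  obtain ⟨w', hw', rfl⟩ := hw
  have hq' := hqc v' hv' w' hw'
  have hmT : (2⁻¹ : ℝ) • (v' + w') ∈ T := by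
    rw [smul_add]
    exact hc hv' hw' (by norm_num) (by norm_num) (by norm_num)
  have hm1 := mem_gauge_smul hT hc h0 one_pos (by rw [one_smul]; exact hmT)
  have hdT : v' - w' ∈ (2 : ℝ) • T := by
    have hw'' : -w' ∈ T := by rw [hsym]; simpa using hw'
    refine ⟨(2⁻¹ : ℝ) • (v' + -w'), ?_, ?_⟩
    · rw [smul_add]
      exact hc hv' hw'' (by norm_num) (by norm_num) (by norm_num)
    · simp [smul_smul, sub_eq_add_neg]
  have hd := mem_gauge_smul hT hc h0 two_pos hdT
  set g := gauge T (v' - w') with hg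
  have hg0 : 0 ≤ g := gauge_nonneg _
  have hgq : 0 ≤ g ^ q := Real.rpow_nonneg hg0 q
  have hm0 : 0 ≤ gauge T ((2⁻¹ : ℝ) • (v' + w')) := gauge_nonneg _
  have hm2 := smul_set_mono hc h0 hm0 hq' hm1
  have hηg : 0 ≤ η * g ^ q := by positivity
  have hk : h₀ ≤ h * (1 - η * g ^ q) := by
    apply hm
    · exact mul_nonneg hh0 (by linarith)
    · nlinarith
    · rw [mul_smul]
      refine ⟨_, hm2, ?_⟩
      simp only [smul_add, smul_smul, mul_comm]
  have hhg : (h * g) ^ q ≤ ρ ^ q := by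
    rw [Real.mul_rpow hh0 hg0]
    have h1 : h ^ q ≤ h := by
      rcases eq_or_lt_of_le hh0 with h' | h'
      · rw [← h', Real.zero_rpow (by linarith)]
      · calc h ^ q ≤ h ^ (1 : ℝ) := Real.rpow_le_rpow_of_exponent_ge h' hh1 (by linarith)
          _ = h := Real.rpow_one h
    have h2 : h ^ q * g ^ q ≤ h * g ^ q := by gcongr
    have h3 : η * (h * g ^ q) ≤ η * ρ ^ q := by nlinarith
    exact h2.trans (le_of_mul_le_mul_left h3 hη)
  have hhg' : h * g ≤ ρ := by
    rwa [Real.rpow_le_rpow_iff (mul_nonneg hh0 hg0) hρ (by linarith)] at hhg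
  refine smul_set_mono hc h0 (mul_nonneg hh0 hg0) hhg' ?_
  rw [mul_smul]
  refine ⟨_, hd, ?_⟩
  simp only [smul_sub]

theorem eta_le_one {T : Set X} (hT : IsCompact T) (hc : Convex ℝ T) (hsym : T = -T)
    (h0 : (0 : X) ∈ T) {q η : ℝ} (hq : 2 ≤ q) (hη : 0 < η)
    (hqc : ∀ x ∈ T, ∀ y ∈ T, gauge T ((2⁻¹ : ℝ) • (x + y)) ≤ 1 - η * gauge T (x - y) ^ q)
    {x : X} (hx : x ∈ T) (hx0 : x ≠ 0) : η ≤ 1 := by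
  have h1 := mem_gauge_smul hT hc h0 one_pos (by simpa using hx)
  obtain ⟨t, ht, hxt⟩ := h1
  have hg0 : 0 ≤ gauge T x := gauge_nonneg _
  have hgp : 0 < gauge T x := by
    rcases eq_or_lt_of_le hg0 with h | h
    · exfalso; apply hx0; rw [← hxt, ← h]; simp
    · exact h
  have hgt : gauge T t = 1 := by
    have : gauge T (gauge T x • t) = gauge T x * gauge T t := gauge_smul_of_nonneg hg0 t
    simp only at hxt
    rw [hxt] at this
    field_simp at this
    exact this.symm
  have hnt : -t ∈ T := by rw [hsym]; simpa using ht
  have h2 := hqc t ht (-t) hnt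
  have h3 : gauge T (t - -t) = 2 := by
    rw [sub_neg_eq_add, ← two_smul ℝ t, gauge_smul_of_nonneg (by norm_num), hgt]; simp
  rw [h3] at h2
  have h4 : 0 ≤ gauge T ((2⁻¹ : ℝ) • (t + -t)) := gauge_nonneg _
  have h5 : (1 : ℝ) ≤ 2 ^ q := Real.one_le_rpow (by norm_num) (by linarith)
  nlinarith

/-- distance in gauge: smallest dilation of `T` meeting the ball of radius `ρ` about `x`. -/
def phiT (T : Set X) (x : X) (ρ : ℝ) : ℝ :=
  sInf {h : ℝ | 0 ≤ h ∧ h ≤ 1 ∧ ∃ v ∈ h • T, ‖x - v‖ ≤ ρ}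

theorem phiT_bdd (T : Set X) (x : X) (ρ : ℝ) :
    BddBelow {h : ℝ | 0 ≤ h ∧ h ≤ 1 ∧ ∃ v ∈ h • T, ‖x - v‖ ≤ ρ} := ⟨0, fun _ h => h.1⟩

theorem phiT_mem {T : Set X} {x : X} (hx : x ∈ T) {ρ : ℝ} (hρ : 0 ≤ ρ) :
    (1 : ℝ) ∈ {h : ℝ | 0 ≤ h ∧ h ≤ 1 ∧ ∃ v ∈ h • T, ‖x - v‖ ≤ ρ} :=
  ⟨by norm_num, le_refl _, x, by simpa using hx, by simpa using hρ⟩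

theorem phiT_nonneg (T : Set X) (x : X) (ρ : ℝ) : 0 ≤ phiT T x ρ :=
  Real.sInf_nonneg fun _ h => h.1

theorem phiT_le_one {T : Set X} {x : X} (hx : x ∈ T) {ρ : ℝ} (hρ : 0 ≤ ρ) : phiT T x ρ ≤ 1 :=
  csInf_le (phiT_bdd T x ρ) (phiT_mem hx hρ)

theorem phiT_anti {T : Set X} {x : X} (hx : x ∈ T) {ρ ρ' : ℝ} (hρ : 0 ≤ ρ) (h : ρ ≤ ρ') :
    phiT T x ρ' ≤ phiT T x ρ :=
  csInf_le_csInf (phiT_bdd T x ρ') ⟨1, phiT_mem hx hρ⟩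
    fun _ ⟨a, b, v, hv, hxv⟩ => ⟨a, b, v, hv, hxv.trans h⟩

theorem splitting {T : Set X} (hT : IsCompact T) (hc : Convex ℝ T) (hsym : T = -T)
    (h0 : (0 : X) ∈ T) {q η : ℝ} (hq : 2 ≤ q) (hη : 0 < η)
    (hqc : ∀ x ∈ T, ∀ y ∈ T, gauge T ((2⁻¹ : ℝ) • (x + y)) ≤ 1 - η * gauge T (x - y) ^ q)
    (N : ℕ) (ε : ℝ) (S : Finset X) (hS : S.card < N)
    (hcov : ∀ t ∈ T, ∃ s ∈ S, ‖t - s‖ ≤ ε) (r D ρ : ℝ) (hr : 8 ≤ r) (hD : 0 < D)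
    (hρ : 0 ≤ ρ) (hρε : ρ * ε ≤ D / (4 * r)) (A : Set X) (hAT : A ⊆ T)
    (hA : ∀ x ∈ A, ∀ y ∈ A, ‖x - y‖ ≤ D) :
    ∃ i : X → ℕ, (∀ x ∈ A, i x < N) ∧
      (∀ x ∈ A, i x = 0 → η * ρ ^ q ≤ phiT T x (2 * (D / r / r)) - phiT T x (2 * D)) ∧
      ∀ x ∈ A, ∀ y ∈ A, i x ≠ 0 → i x = i y → ‖x - y‖ ≤ D / r := by
  classical
  have hr0 : 0 < r := by linarith
  set δ := 2 * (D / r / r) with hδ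
  have hδ0 : 0 ≤ δ := by positivity
  have hδD : δ ≤ D / (4 * r) := by
    have : D / r / r ≤ D / r / 8 := by gcongr
    rw [hδ]
    calc 2 * (D / r / r) ≤ 2 * (D / r / 8) := by linarith
      _ = D / (4 * r) := by field_simp; ring
  have hδD2 : δ ≤ D / 4 := by
    refine hδD.trans ?_
    gcongr
    linarith
  set G : Set X := {x | x ∈ A ∧ phiT T x δ - phiT T x (2 * D) < η * ρ ^ q} with hG
  have hex : ∀ x : X, ∃ hv : ℝ × X, x ∈ G → 0 ≤ hv.1 ∧ hv.1 ≤ 1 ∧ hv.2 ∈ hv.1 • T ∧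
      ‖x - hv.2‖ ≤ δ ∧ hv.1 < phiT T x (2 * D) + η * ρ ^ q := by
    intro x
    by_cases hx : x ∈ G
    · have hlt : phiT T x δ < phiT T x (2 * D) + η * ρ ^ q := by have := hx.2; linarith
      obtain ⟨h, ⟨a, b, v, hv, hxv⟩, hlt'⟩ :=
        exists_lt_of_csInf_lt ⟨1, phiT_mem (hAT hx.1) hδ0⟩ hlt
      exact ⟨(h, v), fun _ => ⟨a, b, hv, hxv, hlt'⟩⟩
    · exact ⟨(0, 0), fun h => absurd h hx⟩
  choose hv hhv using hex
  have asym : ∀ x ∈ G, ∀ y ∈ G, (hv y).1 ≤ (hv x).1 → (hv x).2 - (hv y).2 ∈ ρ • T := by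
    intro x hx y hy hle
    obtain ⟨a1, a2, a3, a4, a5⟩ := hhv x hx
    obtain ⟨b1, b2, b3, b4, b5⟩ := hhv y hy
    refine q_convex_diff hT hc hsym h0 hq hη hqc a1 a2 hρ a3 (smul_set_mono hc h0 b1 hle b3)
      (h₀ := phiT T x (2 * D)) ?_ (by linarith)
    intro k hk0 hk1 hk
    refine csInf_le (phiT_bdd T x (2 * D)) ⟨hk0, hk1, _, hk, ?_⟩
    have e : x - (2⁻¹ : ℝ) • ((hv x).2 + (hv y).2) =
        (2⁻¹ : ℝ) • (x - (hv x).2) + (2⁻¹ : ℝ) • ((x - y) + (y - (hv y).2)) := by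
      module
    rw [e]
    have hxy := hA x hx.1 y hy.1
    have n1 : ‖(2⁻¹ : ℝ) • (x - (hv x).2)‖ = 2⁻¹ * ‖x - (hv x).2‖ := by
      rw [norm_smul]; norm_num
    have n2 : ‖(2⁻¹ : ℝ) • ((x - y) + (y - (hv y).2))‖ = 2⁻¹ * ‖(x - y) + (y - (hv y).2)‖ := by
      rw [norm_smul]; norm_num
    have n3 := norm_add_le (x - y) (y - (hv y).2)
    refine (norm_add_le _ _).trans ?_
    rw [n1, n2]
    linarith
  have symm : ∀ x ∈ G, ∀ y ∈ G, (hv x).2 - (hv y).2 ∈ ρ • T := by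
    intro x hx y hy
    rcases le_total (hv y).1 (hv x).1 with h | h
    · exact asym x hx y hy h
    · obtain ⟨t, ht, hxt⟩ := asym y hy x hx h
      refine ⟨-t, by rw [hsym]; simpa using ht, ?_⟩
      simp only [smul_neg] at hxt ⊢
      rw [hxt]; abel
  by_cases hne : G.Nonempty
  swap
  · refine ⟨fun _ => 0, fun x _ => Nat.zero_lt_of_lt hS, fun x hx _ => ?_, fun x _ y _ h => absurd rfl h⟩
    by_contra hcon
    exact hne ⟨x, hx, not_le.mp hcon⟩
  obtain ⟨x₀, hx₀⟩ := hne
  have hex2 : ∀ x : X, ∃ s : X, x ∈ G → s ∈ S ∧ ‖(hv x).2 - (hv x₀).2 - ρ • s‖ ≤ D / (4 * r) := by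
    intro x
    by_cases hx : x ∈ G
    · obtain ⟨t, ht, hxt⟩ := symm x hx x₀ hx₀
      obtain ⟨s, hs, hts⟩ := hcov t ht
      refine ⟨s, fun _ => ⟨hs, ?_⟩⟩
      simp only at hxt
      rw [← hxt, ← smul_sub, norm_smul, Real.norm_eq_abs, abs_of_nonneg hρ]
      exact (mul_le_mul_of_nonneg_left hts hρ).trans hρε
    · exact ⟨0, fun h => absurd h hx⟩
  choose s hs using hex2
  refine ⟨fun x => if h : x ∈ G then (S.equivFin ⟨s x, (hs x h).1⟩ : ℕ) + 1 else 0, ?_, ?_, ?_⟩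
  · intro x hx
    by_cases h : x ∈ G
    · have := (S.equivFin ⟨s x, (hs x h).1⟩).2
      simp only [h, dif_pos]
      omega
    · simp only [h, dif_neg, not_false_eq_true]; omega
  · intro x hx hi
    by_cases h : x ∈ G
    · simp [h] at hi
    · by_contra hcon
      exact h ⟨hx, not_le.mp hcon⟩
  · intro x hx y hy hne heq
    by_cases h : x ∈ G
    · by_cases h' : y ∈ G
      · simp only [h, h', dif_pos, add_left_inj] at heq
        have e := S.equivFin.injective (Fin.ext heq)
        have e' : s x = s y := congrArg Subtype.val e
        have c1 := (hs x h).2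
        have c2 := (hs y h').2
        have c3 := (hhv x h).2.2.2.1
        have c4 := (hhv y h').2.2.2.1
        rw [← e'] at c2
        have e : x - y = (x - (hv x).2) - (y - (hv y).2) +
            (((hv x).2 - (hv x₀).2 - ρ • s x) - ((hv y).2 - (hv x₀).2 - ρ • s x)) := by abel
        rw [e]
        have d : D / r = 4 * (D / (4 * r)) := by field_simp
        have n1 := norm_sub_le (x - (hv x).2) (y - (hv y).2)
        have n2 := norm_sub_le ((hv x).2 - (hv x₀).2 - ρ • s x) ((hv y).2 - (hv x₀).2 - ρ • s x)
        refine (norm_add_le _ _).trans ?_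
        linarith
      · simp [h, h'] at heq
    · simp [h] at hne

end body

section final

variable {X : Type u} [NormedAddCommGroup X] [NormedSpace ℝ X]

theorem exists_cover {T : Set X} {n : ℕ} {ε : ℝ}
    (h : entN (edist : X → X → ℝ≥0∞) n T < ENNReal.ofReal ε) :
    ∃ S : Finset X, S.card < 2 ^ 2 ^ n ∧ ∀ t ∈ T, ∃ s ∈ S, ‖t - s‖ ≤ ε := by
  unfold entN at h
  simp only [iInf_lt_iff] at h
  obtain ⟨S, hS, h⟩ := h
  refine ⟨S, hS, fun t ht => ?_⟩
  have h1 : ⨅ y ∈ S, edist t y < ENNReal.ofReal ε :=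
    lt_of_le_of_lt (le_iSup₂ (f := fun x (_ : x ∈ T) => ⨅ y ∈ S, edist x y) t ht) h
  simp only [iInf_lt_iff] at h1
  obtain ⟨s, hs, h1⟩ := h1
  refine ⟨s, hs, ?_⟩
  rw [edist_dist, ENNReal.ofReal_lt_ofReal_iff'] at h1
  rw [← dist_eq_norm]
  exact h1.1.le

theorem gammaF_subsingleton {T : Set X} (hT : T.Subsingleton) (α q : ℝ) (hq : 2 ≤ q) :
    gammaF (edist : X → X → ℝ≥0∞) α q T = 0 := by
  let P : Admissible T :=
    { piece := fun _ _ => T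
      self_mem := fun _ _ hx => hx
      subset_base := fun _ _ _ => subset_rfl
      partition := fun _ _ _ _ _ _ => rfl
      finite_pieces := fun n => (Set.finite_singleton T).subset (by rintro A ⟨x, _, rfl⟩; rfl)
      card_pieces := fun n => by
        have : {A : Set X | ∃ x ∈ T, T = A}.ncard ≤ 1 := by
          rw [← Set.ncard_singleton T]
          exact Set.ncard_le_ncard (by rintro A ⟨x, _, rfl⟩; rfl)
        exact lt_of_le_of_lt this (Nat.one_lt_two_pow (by positivity))
      nested := fun _ _ _ => subset_rfl }
  refine le_antisymm ((iInf_le _ P).trans ?_) (zero_le)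
  have hd : eDiam (edist : X → X → ℝ≥0∞) T = 0 := by
    unfold eDiam
    simp only [ENNReal.iSup_eq_zero]
    intro x hx y hy
    rw [hT hx hy, edist_self]
  have hq0 : 0 < q := by linarith
  have : ∀ n x, P.piece n x = T := fun _ _ => rfl
  simp [this, hd, ENNReal.zero_rpow_of_pos hq0, ENNReal.zero_rpow_of_pos (inv_pos.mpr hq0)]

theorem core {T : Set X} (hT : IsCompact T) (hc : Convex ℝ T) (hsym : T = -T)
    (h0 : (0 : X) ∈ T) {q η : ℝ} (hq : 2 ≤ q) (hη : 0 < η) (hη1 : η ≤ 1)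
    (hqc : ∀ x ∈ T, ∀ y ∈ T, gauge T ((2⁻¹ : ℝ) • (x + y)) ≤ 1 - η * gauge T (x - y) ^ q)
    (lam : ℝ) (hlam : 1 < lam) (s : ℝ) (hs : 0 < s)
    (hcov : ∀ n : ℕ, ∃ S : Finset X, S.card < 2 ^ 2 ^ n ∧ ∀ t ∈ T, ∃ y ∈ S,
      ‖t - y‖ ≤ s / lam ^ n) :
    ∃ (P : Admissible T) (D : ℕ → X → ℝ), (∀ n x, 0 ≤ D n x) ∧
      (∀ n, ∀ x ∈ T, ∀ y ∈ P.piece n x, ∀ z ∈ P.piece n x, ‖y - z‖ ≤ D n x) ∧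
      ∀ x ∈ T, ∀ N, ∑ n ∈ Finset.range N, (lam ^ n * D n x) ^ q ≤
        (128 * (lam ^ 2 / (lam ^ 2 - 1)) * lam ^ 2 * s) ^ q / η := by
  have hq0 : 0 < q := by linarith
  have hlam0 : 0 < lam := by linarith
  set r : ℝ := 8 * lam with hr
  have hr8 : 8 ≤ r := by linarith
  have hr0 : 0 < r := by linarith
  set Δ : ℕ → ℝ := fun j => 2 * s / r ^ j with hΔ
  have hΔ0 : ∀ j, 0 < Δ j := fun j => by positivity
  have hΔS : ∀ j, Δ (j + 1) = Δ j / r := fun j => by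
    simp only [hΔ, pow_succ]; field_simp
  have hΔanti : Antitone Δ := antitone_nat_of_succ_le fun j => by
    rw [hΔS]; exact div_le_self (hΔ0 j).le (by linarith)
  obtain ⟨P, j, hj0, hgood, hstep⟩ := build_admissible T (fun j x y => ‖x - y‖ ≤ Δ j)
    (fun n j x => η * (Δ j * lam ^ n / (4 * r * s)) ^ q ≤
      phiT T x (2 * Δ (j + 2)) - phiT T x (2 * Δ j))
    (by
      intro x hx y hy
      obtain ⟨S, hS, hcov⟩ := hcov 0
      obtain ⟨a, ha, hxa⟩ := hcov x hx
      obtain ⟨b, hb, hyb⟩ := hcov y hy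
      have hab : a = b := Finset.card_le_one.mp (by simpa using Nat.le_of_lt_succ hS) a ha b hb
      rw [← hab] at hyb
      have e : x - y = (x - a) - (y - a) := by abel
      rw [e]
      refine (norm_sub_le _ _).trans ?_
      simp only [hΔ, pow_zero, div_one] at *
      linarith)
    (by
      intro n j A hAT hA
      obtain ⟨S, hS, hcov⟩ := hcov n
      have := splitting hT hc hsym h0 hq hη hqc (2 ^ 2 ^ n) (s / lam ^ n) S hS hcov r (Δ j)
        (Δ j * lam ^ n / (4 * r * s)) hr8 (hΔ0 j) (by have := hΔ0 j; positivity)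
        (le_of_eq (by field_simp)) A hAT hA
      rw [← hΔS, ← hΔS] at this
      exact this)
  refine ⟨P, fun n x => Δ (j n x), fun n x => (hΔ0 _).le, hgood, ?_⟩
  intro x hx N
  have hL : lam ^ 2 ≤ lam ^ q := by
    rw [← Real.rpow_natCast]
    exact Real.rpow_le_rpow_of_exponent_le hlam.le (by exact_mod_cast hq)
  have hl2 : 1 < lam ^ 2 := by nlinarith
  have hL1 : 1 < lam ^ q := by linarith
  set K : ℝ := (4 * r * s) ^ q / η with hK
  have hK0 : 0 ≤ K := by positivity
  have hsum := chain_sum (fun n => (lam ^ n * Δ (j n x)) ^ q) (fun n => j n x)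
    (fun i => phiT T x (2 * Δ i)) K (lam ^ q)
    (fun n => by have := hΔ0 (j n x); positivity)
    (fun a b hab => phiT_anti hx (by have := hΔ0 b; positivity)
      (by have := hΔanti hab; linarith))
    (fun _ => phiT_nonneg _ _ _)
    (fun i => phiT_le_one hx (by have := hΔ0 i; positivity)) hK0 hL1
    (by
      intro n
      have hd := hΔ0 (j n x)
      rcases hstep n x hx with h | ⟨h, hb⟩
      · left
        refine ⟨h, ?_⟩
        simp only [h, hΔS]
        have e : lam ^ (n + 1) * (Δ (j n x) / r) = (1 / 8) * (lam ^ n * Δ (j n x)) := by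
          rw [hr]; field_simp; ring
        rw [e, Real.mul_rpow (by norm_num) (by positivity)]
        have h8 : (1 / 8 : ℝ) ^ q ≤ 1 / 4 := by
          calc (1 / 8 : ℝ) ^ q ≤ (1 / 8 : ℝ) ^ (1 : ℝ) :=
                Real.rpow_le_rpow_of_exponent_ge (by norm_num) (by norm_num) (by linarith)
            _ ≤ 1 / 4 := by rw [Real.rpow_one]; norm_num
        have : 0 ≤ (lam ^ n * Δ (j n x)) ^ q := by positivity
        nlinarith
      · right
        refine ⟨h, ?_, ?_⟩
        · simp only [h]
          rw [← Real.mul_rpow hlam0.le (by positivity)]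
          congr 1
          ring
        · have e : lam ^ n * Δ (j n x) = (4 * r * s) * (Δ (j n x) * lam ^ n / (4 * r * s)) := by
            field_simp
          rw [e, Real.mul_rpow (by positivity) (by positivity), hK,
            div_mul_eq_mul_div ((4 * r * s) ^ q) η,
            le_div_iff₀ hη]
          have : 0 ≤ (4 * r * s) ^ q := by positivity
          nlinarith) N
  refine hsum.trans ?_
  simp only [hj0 x hx, pow_zero, one_mul]
  set κ := lam ^ 2 / (lam ^ 2 - 1) with hκ
  have hκ1 : 1 ≤ κ := by
    rw [hκ, le_div_iff₀ (by linarith)]; linarith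
  have hκL : lam ^ q / (lam ^ q - 1) ≤ κ := by
    rw [hκ, div_le_div_iff₀ (by linarith) (by linarith)]
    nlinarith
  have hΔz : Δ 0 = 2 * s := by simp [hΔ]
  rw [hΔz]
  have a1 : (2 * s) ^ q ≤ (4 * r * s * lam) ^ q / η := by
    rw [le_div_iff₀ hη]
    have : (2 * s) ^ q ≤ (4 * r * s * lam) ^ q := by
      apply Real.rpow_le_rpow (by positivity) _ hq0.le
      have : 2 ≤ 4 * r * lam := by nlinarith
      nlinarith
    have h2 : 0 ≤ (2 * s) ^ q := by positivity
    nlinarith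
  have a2 : lam ^ q * K = (4 * r * s * lam) ^ q / η := by
    rw [hK, Real.mul_rpow (x := 4 * r * s) (by positivity) hlam0.le]; ring
  set Q := (4 * r * s * lam) ^ q / η with hQ
  have hQ0 : 0 ≤ Q := by positivity
  have a3 : lam ^ q * (2 * (lam ^ q / (lam ^ q - 1) * K)) ≤ 2 * κ * Q := by
    rw [← a2]
    have : 0 ≤ lam ^ q * K := by rw [a2]; exact hQ0
    nlinarith [mul_le_mul_of_nonneg_right hκL this]
  have a4 : 128 * κ * lam ^ 2 * s = (4 * κ) * (4 * r * s * lam) := by rw [hr]; ring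
  have a5 : 4 * κ ≤ (4 * κ) ^ q := by
    calc 4 * κ = (4 * κ) ^ (1 : ℝ) := (Real.rpow_one _).symm
      _ ≤ _ := Real.rpow_le_rpow_of_exponent_le (by linarith) (by linarith)
  rw [a4, Real.mul_rpow (x := 4 * κ) (by positivity) (by positivity), mul_div_assoc, ← hQ]
  have a6 : 4 * κ * Q ≤ (4 * κ) ^ q * Q := mul_le_mul_of_nonneg_right a5 hQ0
  nlinarith

theorem two_rpow_eq (α : ℝ) (n : ℕ) :
    (2 : ℝ≥0∞) ^ ((n : ℝ) / α) = ENNReal.ofReal (((2 : ℝ) ^ (1 / α)) ^ n) := by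
  rw [← Real.rpow_natCast, ← Real.rpow_mul (by norm_num),
    ← ENNReal.ofReal_rpow_of_pos (by norm_num)]
  congr 1
  · simp
  · ring

end final

/-- **Chaining functionals on q-convex bodies** (Theorem 5.7). If `T` is a
symmetric compact convex set that is `q`-convex with constant `η` (`q ≥ 2`), then
`γ_{α,q}(T) ≤ C η^{−1/q} sup_n 2^{n/α} e_n(T)` with `C` depending only on `α`. -/
theorem q_convex_chaining (α : ℝ) (hα : 0 < α) :
    ∃ C : ℝ≥0∞, 0 < C ∧ C ≠ ∞ ∧
      ∀ (X : Type u) [NormedAddCommGroup X] [NormedSpace ℝ X] [CompleteSpace X]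
        (T : Set X), IsCompact T → Convex ℝ T → T = -T →
        ∀ q η : ℝ, 2 ≤ q → 0 < η →
          (∀ x ∈ T, ∀ y ∈ T,
            gauge T ((2⁻¹ : ℝ) • (x + y)) ≤ 1 - η * gauge T (x - y) ^ q) →
          gammaF (edist : X → X → ℝ≥0∞) α q T ≤
            C * ENNReal.ofReal η ^ (-(1 / q)) *
              ⨆ n : ℕ, (2 : ℝ≥0∞) ^ ((n : ℝ) / α) *
                entN (edist : X → X → ℝ≥0∞) n T := by
  set lam : ℝ := (2 : ℝ) ^ (1 / α) with hlamdef
  have hlam : 1 < lam := Real.one_lt_rpow (by norm_num) (by positivity)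
  have hl2 : 1 < lam ^ 2 := by nlinarith
  have hl3 : 0 < lam ^ 2 - 1 := by linarith
  set c : ℝ := 128 * (lam ^ 2 / (lam ^ 2 - 1)) * lam ^ 2 with hc
  have hc0 : 0 < c := by positivity
  refine ⟨ENNReal.ofReal c, ENNReal.ofReal_pos.mpr hc0, ENNReal.ofReal_ne_top, ?_⟩
  intro X _ _ _ T hT hcx hsym q η hq hη hqc
  have hq0 : 0 < q := by linarith
  by_cases hsub : T.Subsingleton
  · rw [gammaF_subsingleton hsub α q hq]; exact zero_le
  obtain ⟨x, hx, hx0⟩ : ∃ x ∈ T, x ≠ 0 := by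
    by_contra hcon
    push Not at hcon
    exact hsub fun a ha b hb => (hcon a ha).trans (hcon b hb).symm
  have h0 : (0 : X) ∈ T := by
    have hnx : -x ∈ T := by rw [hsym]; simpa using hx
    have := hcx hx hnx (show (0 : ℝ) ≤ 2⁻¹ by norm_num) (show (0 : ℝ) ≤ 2⁻¹ by norm_num)
      (by norm_num)
    simpa using this
  have hη1 := eta_le_one hT hcx hsym h0 hq hη hqc hx hx0
  set M : ℝ≥0∞ := ⨆ n : ℕ, (2 : ℝ≥0∞) ^ ((n : ℝ) / α) *
    entN (edist : X → X → ℝ≥0∞) n T with hM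
  set B : ℝ≥0∞ := ENNReal.ofReal c * ENNReal.ofReal η ^ (-(1 / q)) with hB
  have hBeq : B = ENNReal.ofReal (c * η ^ (-(1 / q))) := by
    rw [hB, ENNReal.ofReal_mul hc0.le, ENNReal.ofReal_rpow_of_pos hη]
  have hBpos : 0 < c * η ^ (-(1 / q)) := by positivity
  have hBt : B ≠ ∞ := by rw [hBeq]; exact ENNReal.ofReal_ne_top
  have hB0 : B ≠ 0 := by rw [hBeq]; exact (ENNReal.ofReal_pos.mpr hBpos).ne'
  have key : ∀ s : ℝ, 0 < s → M < ENNReal.ofReal s →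
      gammaF (edist : X → X → ℝ≥0∞) α q T ≤ B * ENNReal.ofReal s := by
    intro s hs hMs
    obtain ⟨P, D, hD0, hD, hsum⟩ := core hT hcx hsym h0 hq hη hη1 hqc lam hlam s hs (by
      intro n
      apply exists_cover
      have h1 : (2 : ℝ≥0∞) ^ ((n : ℝ) / α) * entN (edist : X → X → ℝ≥0∞) n T
          < ENNReal.ofReal s :=
        lt_of_le_of_lt (le_iSup (fun n : ℕ => (2 : ℝ≥0∞) ^ ((n : ℝ) / α) *
          entN (edist : X → X → ℝ≥0∞) n T) n) hMs
      rw [two_rpow_eq] at h1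
      have hp : 0 < lam ^ n := by positivity
      rw [ENNReal.ofReal_div_of_pos hp]
      rw [ENNReal.lt_div_iff_mul_lt (Or.inl (ENNReal.ofReal_pos.mpr hp).ne')
        (Or.inl ENNReal.ofReal_ne_top), mul_comm]
      exact h1)
    refine (iInf_le _ P).trans ?_
    have h1 : (⨆ x ∈ T, ∑' n : ℕ, ((2 : ℝ≥0∞) ^ ((n : ℝ) / α) *
        eDiam (edist : X → X → ℝ≥0∞) (P.piece n x)) ^ q) ≤
        ENNReal.ofReal ((c * s) ^ q / η) := by
      refine iSup₂_le fun x hx => ?_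
      refine ENNReal.tsum_le_of_sum_range_le fun N => ?_
      refine le_trans ?_ (ENNReal.ofReal_le_ofReal (hsum x hx N))
      rw [ENNReal.ofReal_sum_of_nonneg (fun n _ => by have := hD0 n x; positivity)]
      refine Finset.sum_le_sum fun n _ => ?_
      rw [← ENNReal.ofReal_rpow_of_nonneg (by have := hD0 n x; positivity) hq0.le]
      refine ENNReal.rpow_le_rpow ?_ hq0.le
      rw [ENNReal.ofReal_mul (by positivity), two_rpow_eq]
      gcongr
      unfold eDiam
      refine iSup₂_le fun y hy => iSup₂_le fun z hz => ?_
      rw [edist_dist, dist_eq_norm]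
      exact ENNReal.ofReal_le_ofReal (hD n x hx y hy z hz)
    refine (ENNReal.rpow_le_rpow h1 (by positivity)).trans (le_of_eq ?_)
    rw [ENNReal.ofReal_rpow_of_nonneg (by positivity) (by positivity), hBeq,
      ← ENNReal.ofReal_mul hBpos.le]
    congr 1
    rw [Real.div_rpow (by positivity) hη.le, Real.rpow_rpow_inv (by positivity) hq0.ne',
      Real.rpow_neg hη.le, one_div]
    ring
  rcases eq_or_ne M ∞ with hMt | hMt
  · rw [hMt, ENNReal.mul_top hB0]; exact le_top
  refine ENNReal.le_of_forall_pos_le_add ?_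
  intro ε hε _
  have hb : 0 < c * η ^ (-(1 / q)) := hBpos
  set b := c * η ^ (-(1 / q)) with hbdef
  have hMn : 0 ≤ M.toReal := ENNReal.toReal_nonneg
  have hεr : (0 : ℝ) < ε := hε
  have hs : 0 < M.toReal + ε / b := by positivity
  have := key (M.toReal + ε / b) hs (by
    rw [ENNReal.lt_ofReal_iff_toReal_lt hMt]
    have : 0 < (ε : ℝ) / b := by positivity
    linarith)
  refine this.trans (le_of_eq ?_)
  rw [ENNReal.ofReal_add hMn (by positivity), ENNReal.ofReal_toReal hMt, mul_add]
  congr 1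
  rw [hBeq, ← ENNReal.ofReal_mul hb.le, mul_div_cancel₀ _ hb.ne', ENNReal.ofReal_coe_nnreal]
end
end
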